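/- There is a constant δ > 0 such that for every real K > 1 and every integer n ≥ 2 there exists an n×n complex matrix R with the following two properties: (1) for every complex polynomial p, ‖p(R)‖ ≤ K · sup_{|z| ≤ 1} |p(z)|; and (2) for every invertible n×n complex matrix A with ‖A R A⁻¹‖ ≤ 1, one has ‖A‖ · ‖A⁻¹‖ ≥ δ (K − 1) √(log n). -/

import Mathlib

open Matrix

section MatrixPolynomialBounds

open Finset

theorem sum_norm_sq_sum_pow_smul {H : Type*} [NormedAddCommGroup H] [InnerProductSpace ℂ H]
    {Q : ℕ} (hQ : Q ≠ 0) {ζ : ℂ} (hζ : IsPrimitiveRoot ζ Q) (v : ℕ → H) :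
    ∑ a ∈ range Q, ‖∑ i ∈ range Q, (ζ ^ a) ^ i • v i‖ ^ 2 = Q * ∑ i ∈ range Q, ‖v i‖ ^ 2 := by
  have hn : ‖ζ‖ = 1 := hζ.norm'_eq_one hQ
  have key : ∀ i ∈ range Q, ∀ j ∈ range Q,
      ∑ a ∈ range Q, (starRingEnd ℂ) ((ζ ^ a) ^ i) * (ζ ^ a) ^ j =
        if i = j then (Q : ℂ) else 0 := by
    intro i hi j hj
    have hz0 : ζ ≠ 0 := hζ.ne_zero hQ
    have hc : (starRingEnd ℂ) ζ = ζ⁻¹ := (Complex.inv_eq_conj hn).symm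
    have h1 : ∀ a, (starRingEnd ℂ) ((ζ ^ a) ^ i) * (ζ ^ a) ^ j = (ζ ^ j * (ζ ^ i)⁻¹) ^ a := by
      intro a
      rw [map_pow, map_pow, hc]
      rw [mul_pow, inv_pow, inv_pow, inv_pow, ← pow_mul, ← pow_mul, ← pow_mul, ← pow_mul,
        mul_comm a i, mul_comm a j, mul_comm]
    simp_rw [h1]
    split_ifs with h
    · subst h
      simp [hz0]
    · have hne : ζ ^ j * (ζ ^ i)⁻¹ ≠ 1 := by
        intro h2
        rw [← div_eq_mul_inv, div_eq_one_iff_eq (pow_ne_zero _ hz0)] at h2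
        exact h (hζ.pow_inj (mem_range.1 hi) (mem_range.1 hj) h2.symm)
      have h3 := geom_sum_mul (ζ ^ j * (ζ ^ i)⁻¹) Q
      have h4 : (ζ ^ j * (ζ ^ i)⁻¹) ^ Q = 1 := by
        rw [mul_pow, inv_pow, ← pow_mul, ← pow_mul, mul_comm j, mul_comm i, pow_mul, pow_mul,
          hζ.pow_eq_one]; simp
      rw [h4, sub_self] at h3
      exact (mul_eq_zero.1 h3).resolve_right (sub_ne_zero.2 hne)
  have : (∑ a ∈ range Q, (‖∑ i ∈ range Q, (ζ ^ a) ^ i • v i‖ : ℂ) ^ 2) =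
      Q * ∑ i ∈ range Q, (‖v i‖ : ℂ) ^ 2 := by
    have h5 : ∀ w : H, ((‖w‖ : ℂ)) ^ 2 = inner ℂ w w := fun w =>
      (inner_self_eq_norm_sq_to_K (𝕜 := ℂ) w).symm
    simp_rw [h5, sum_inner, inner_sum, inner_smul_left, inner_smul_right]
    rw [sum_comm, mul_sum]
    refine sum_congr rfl fun i hi => ?_
    rw [sum_comm]
    simp_rw [← mul_assoc, ← sum_mul]
    rw [sum_congr rfl fun j hj => by rw [key i hi j hj]]
    simp [mem_range.1 hi]
  exact_mod_cast this

theorem sum_norm_sq_antidiagonal_le {H H' : Type*} [NormedAddCommGroup H] [InnerProductSpace ℂ H]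
    [NormedAddCommGroup H'] [InnerProductSpace ℂ H'] {L : ℕ} {c : ℝ}
    (B : ℕ → H →ₗ[ℂ] H') (hB : ∀ z : ℂ, ‖z‖ = 1 → ∀ v, ‖∑ l ∈ range L, z ^ l • B l v‖ ≤ c * ‖v‖)
    (hL : ∀ l, L ≤ l → B l = 0) (N : ℕ) (x : ℕ → H) :
    ∑ i ∈ range N, ‖∑ q ∈ antidiagonal i, B q.1 (x q.2)‖ ^ 2 ≤
      c ^ 2 * ∑ i ∈ range N, ‖x i‖ ^ 2 := by
  rcases Nat.eq_zero_or_pos N with rfl | hN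
  · simp
  set Q := L + N with hQdef
  have hQ : Q ≠ 0 := by omega
  obtain ⟨ζ, hζ⟩ : ∃ ζ : ℂ, IsPrimitiveRoot ζ Q := ⟨_, Complex.isPrimitiveRoot_exp Q hQ⟩
  have hn : ‖ζ‖ = 1 := hζ.norm'_eq_one hQ
  let y : ℕ → H := fun s => if s < N then x s else 0
  let w : ℕ → H' := fun i => ∑ j ∈ range L, ∑ s ∈ range N, if j + s = i then B j (x s) else 0
  have hw : ∀ i ∈ range N, ∑ q ∈ antidiagonal i, B q.1 (x q.2) = w i := by
    intro i hi
    have hi := mem_range.1 hi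
    simp only [w]
    rw [← sum_product' (f := fun j s => if j + s = i then B j (x s) else 0), ← sum_filter]
    symm
    apply sum_subset
    · intro q; simp
    · rintro ⟨j, s⟩ h1 h2
      simp only [HasAntidiagonal.mem_antidiagonal, mem_filter, mem_product, mem_range,
        not_and] at h1 h2
      have : ¬ j < L := by
        intro h3; exact h2 ⟨h3, by omega⟩ h1
      simp [hL j (by omega)]
  have hprod : ∀ z : ℂ, ∑ i ∈ range Q, z ^ i • w i =
      ∑ l ∈ range L, z ^ l • B l (∑ s ∈ range N, z ^ s • x s) := by
    intro z
    simp only [w, smul_sum, map_sum, map_smul]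
    rw [sum_comm]
    refine sum_congr rfl fun j hj => ?_
    rw [sum_comm]
    refine sum_congr rfl fun s hs => ?_
    simp only [smul_ite, smul_zero]
    rw [sum_ite_eq, if_pos, smul_smul, pow_add]
    simp only [mem_range] at *; omega
  have hy : ∀ z : ℂ, ∑ i ∈ range Q, z ^ i • y i = ∑ s ∈ range N, z ^ s • x s := by
    intro z
    simp only [y, smul_ite, smul_zero]
    rw [← sum_filter]
    refine sum_congr ?_ fun _ _ => rfl
    ext; simp; omega
  have hy2 : ∑ i ∈ range Q, ‖y i‖ ^ 2 = ∑ i ∈ range N, ‖x i‖ ^ 2 := by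
    have : ∀ i, ‖y i‖ ^ 2 = if i < N then ‖x i‖ ^ 2 else 0 := by
      intro i; simp only [y]; split_ifs <;> simp
    simp_rw [this]
    rw [← sum_filter]
    refine sum_congr ?_ fun _ _ => rfl
    ext; simp; omega
  have h1 := sum_norm_sq_sum_pow_smul hQ hζ w
  have h2 := sum_norm_sq_sum_pow_smul hQ hζ y
  have h3 : ∑ a ∈ range Q, ‖∑ i ∈ range Q, (ζ ^ a) ^ i • w i‖ ^ 2 ≤
      c ^ 2 * ∑ a ∈ range Q, ‖∑ i ∈ range Q, (ζ ^ a) ^ i • y i‖ ^ 2 := by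
    rw [mul_sum]
    refine sum_le_sum fun a _ => ?_
    rw [hprod, hy, ← mul_pow]
    exact pow_le_pow_left₀ (norm_nonneg _) (hB _ (by simp [hn]) _) 2
  rw [h1, h2, hy2] at h3
  have hQ' : (0 : ℝ) < Q := by positivity
  have h4 : ∑ i ∈ range Q, ‖w i‖ ^ 2 ≤ c ^ 2 * ∑ i ∈ range N, ‖x i‖ ^ 2 := by
    refine le_of_mul_le_mul_left ?_ hQ'
    linarith
  refine le_trans ?_ h4
  rw [sum_congr rfl fun i hi => by rw [hw i hi]]
  exact sum_le_sum_of_subset_of_nonneg (range_subset_range.2 (by omega)) fun _ _ _ => by positivity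

theorem exists_corner_completion {V W G : Type*} [NormedAddCommGroup V] [InnerProductSpace ℂ V]
    [FiniteDimensional ℂ V] [NormedAddCommGroup W] [InnerProductSpace ℂ W] [FiniteDimensional ℂ W]
    [NormedAddCommGroup G] [InnerProductSpace ℂ G] {a b : ℝ} (ha : 0 ≤ a) (hab : a < b)
    (D : V →ₗ[ℂ] W) (B : V →ₗ[ℂ] G) (C : W)
    (hcol : ∀ v, ‖B v‖ ^ 2 + ‖D v‖ ^ 2 ≤ a ^ 2 * ‖v‖ ^ 2)
    (hrow : ∀ v, ‖C + D v‖ ^ 2 ≤ b ^ 2 * (1 + ‖v‖ ^ 2)) :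
    ∃ X : G, ∀ v, ‖X + B v‖ ^ 2 + ‖C + D v‖ ^ 2 ≤ b ^ 2 * (1 + ‖v‖ ^ 2) := by
  have hab2 : a ^ 2 < b ^ 2 := by nlinarith
  let F : V →ₗ[ℂ] V := ((b : ℂ) ^ 2) • LinearMap.id - D.adjoint ∘ₗ D
  have hF : ∀ v w, inner ℂ (F v) w = ((b : ℂ) ^ 2) * inner ℂ v w - inner ℂ (D v) (D w) := by
    intro v w
    simp [F, LinearMap.adjoint_inner_left, mul_comm]
  have hinj : Function.Injective F := by
    rw [← LinearMap.ker_eq_bot, LinearMap.ker_eq_bot']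
    intro v hv
    have h := hF v v
    rw [hv, inner_zero_left, inner_self_eq_norm_sq_to_K, inner_self_eq_norm_sq_to_K] at h
    have h' : (0 : ℝ) = b ^ 2 * ‖v‖ ^ 2 - ‖D v‖ ^ 2 := by
      apply Complex.ofReal_injective
      push_cast
      exact h
    have h2 := hcol v
    have h3 : (b ^ 2 - a ^ 2) * ‖v‖ ^ 2 ≤ 0 := by nlinarith [sq_nonneg ‖B v‖]
    have h4 : ‖v‖ ^ 2 ≤ 0 := by
      by_contra h5
      push Not at h5
      nlinarith
    have : ‖v‖ = 0 := by nlinarith [norm_nonneg v]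
    exact norm_eq_zero.1 this
  obtain ⟨v₀, hv₀⟩ := (LinearMap.injective_iff_surjective.1 hinj) (D.adjoint C)
  have horth : ∀ w, ((b : ℂ) ^ 2) * inner ℂ v₀ w = inner ℂ (C + D v₀) (D w) := by
    intro w
    have := hF v₀ w
    rw [hv₀, LinearMap.adjoint_inner_left] at this
    rw [inner_add_left, this]; ring
  refine ⟨-B v₀, fun v => ?_⟩
  obtain ⟨w, rfl⟩ : ∃ w, v = v₀ + w := ⟨v - v₀, by simp⟩
  have e1 : -B v₀ + B (v₀ + w) = B w := by simp
  have e2 : C + D (v₀ + w) = (C + D v₀) + D w := by simp [add_assoc]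
  have hre : b ^ 2 * RCLike.re (inner ℂ v₀ w) = RCLike.re (inner ℂ (C + D v₀) (D w)) := by
    rw [← horth w]
    have : ((b : ℂ) ^ 2) = ((b ^ 2 : ℝ) : ℂ) := by push_cast; rfl
    rw [this]
    simp [-Complex.ofReal_pow]
  rw [e1, e2, norm_add_sq (𝕜 := ℂ) (C + D v₀), norm_add_sq (𝕜 := ℂ) v₀]
  have h1 := hcol w
  have h2 := hrow v₀
  nlinarith [sq_nonneg ‖w‖]

theorem norm_sq_anticomm_le {ι κ : Type*} [Fintype ι] [DecidableEq ι] [Fintype κ] [DecidableEq κ]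
    (U : κ → Matrix ι ι ℂ) (hU : ∀ k, (U k)ᴴ = U k)
    (hac : ∀ k l, U k * U l + U l * U k = if k = l then 2 else 0) (a : κ → ℂ)
    (v : EuclideanSpace ℂ ι) :
    ‖∑ k, a k • Matrix.toEuclideanCLM (𝕜 := ℂ) (U k) v‖ ^ 2 ≤ 2 * (∑ k, ‖a k‖ ^ 2) * ‖v‖ ^ 2 := by
  set X : Matrix ι ι ℂ := ∑ k, a k • U k with hX
  have hXs : Xᴴ = ∑ k, star (a k) • U k := by
    simp [hX, conjTranspose_sum, hU]
  have hsum : Xᴴ * X + X * Xᴴ = ((2 * ∑ k, ‖a k‖ ^ 2 : ℝ) : ℂ) • (1 : Matrix ι ι ℂ) := by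
    rw [hXs, hX, sum_mul_sum, sum_mul_sum,
      sum_comm (s := univ) (t := univ) (f := fun i j => a i • U i * star (a j) • U j),
      ← sum_add_distrib]
    have : ∀ k l : κ, star (a k) • U k * a l • U l + a l • U l * star (a k) • U k =
        if k = l then ((2 * ‖a k‖ ^ 2 : ℝ) : ℂ) • (1 : Matrix ι ι ℂ) else 0 := by
      intro k l
      rw [smul_mul_smul_comm, smul_mul_smul_comm, mul_comm (a l), ← smul_add, hac]
      split_ifs with h
      · subst h
        have h2 : star (a k) * a k = ((‖a k‖ ^ 2 : ℝ) : ℂ) := by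
          rw [Complex.star_def, Complex.conj_mul']; push_cast; rfl
        rw [h2]
        have h3 : (2 : Matrix ι ι ℂ) = (2 : ℂ) • 1 := by
          rw [two_smul, one_add_one_eq_two]
        rw [h3, smul_smul]; push_cast; ring_nf
      · simp
    simp_rw [← sum_add_distrib, this]
    simp only [sum_ite_eq, mem_univ, if_true]
    rw [← sum_smul]; push_cast; rw [mul_sum]
  have e : ∑ k, a k • Matrix.toEuclideanCLM (𝕜 := ℂ) (U k) v =
      Matrix.toEuclideanCLM (𝕜 := ℂ) X v := by
    simp [hX, map_sum]
  rw [e]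
  set T := Matrix.toEuclideanCLM (𝕜 := ℂ) X with hT
  have hT2 : star T * T + T * star T = ((2 * ∑ k, ‖a k‖ ^ 2 : ℝ) : ℂ) • 1 := by
    rw [hT, ← map_star, ← map_mul, ← map_mul, ← map_add, star_eq_conjTranspose, hsum,
      map_smul, map_one]
  have h1 : ‖T v‖ ^ 2 + ‖star T v‖ ^ 2 = 2 * (∑ k, ‖a k‖ ^ 2) * ‖v‖ ^ 2 := by
    have h := congrArg (fun Z : EuclideanSpace ℂ ι →L[ℂ] EuclideanSpace ℂ ι => inner ℂ (Z v) v) hT2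
    simp only [_root_.add_apply, mul_apply_eq_comp, inner_add_left,
      _root_.smul_apply, one_apply_eq_self, inner_smul_left] at h
    rw [ContinuousLinearMap.star_eq_adjoint, ContinuousLinearMap.adjoint_inner_left,
      ← ContinuousLinearMap.adjoint_inner_right T (T.adjoint v) v, inner_self_eq_norm_sq_to_K,
      inner_self_eq_norm_sq_to_K, inner_self_eq_norm_sq_to_K, Complex.conj_ofReal] at h
    rw [ContinuousLinearMap.star_eq_adjoint]
    apply Complex.ofReal_injective
    push_cast at h ⊢
    exact h
  nlinarith [sq_nonneg ‖star T v‖]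

theorem exists_anticomm_family (m : ℕ) :
    ∃ U : Fin (m + 1) → Matrix (Fin (2 ^ m)) (Fin (2 ^ m)) ℂ, (∀ k, (U k)ᴴ = U k) ∧
      ∀ k l, U k * U l + U l * U k = if k = l then 2 else 0 := by
  induction m with
  | zero =>
    refine ⟨fun _ => 1, by simp, fun k l => ?_⟩
    rw [if_pos (Subsingleton.elim (α := Fin 1) k l)]
    simp [one_add_one_eq_two]
  | succ m ih =>
    obtain ⟨U, hU, hac⟩ := ih
    let e : Fin (2 ^ m) ⊕ Fin (2 ^ m) ≃ Fin (2 ^ (m + 1)) :=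
      finSumFinEquiv.trans (finCongr (by ring))
    let f := Matrix.reindexAlgEquiv ℂ ℂ e
    let W : Fin (m + 2) → Matrix (Fin (2 ^ m) ⊕ Fin (2 ^ m)) (Fin (2 ^ m) ⊕ Fin (2 ^ m)) ℂ :=
      Fin.cons (fromBlocks 0 1 1 0) (fun k => fromBlocks (U k) 0 0 (-U k))
    have hW : ∀ k, (W k)ᴴ = W k := by
      intro k
      refine Fin.cases ?_ (fun k => ?_) k
      · simp [W, fromBlocks_conjTranspose]
      · simp [W, fromBlocks_conjTranspose, hU]
    have hWac : ∀ k l, W k * W l + W l * W k = if k = l then 2 else 0 := by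
      have h2 : (2 : Matrix (Fin (2 ^ m) ⊕ Fin (2 ^ m)) (Fin (2 ^ m) ⊕ Fin (2 ^ m)) ℂ) =
        fromBlocks 2 0 0 2 := by
        rw [← one_add_one_eq_two (R := Matrix (Fin (2 ^ m) ⊕ Fin (2 ^ m)) _ ℂ), ← fromBlocks_one,
          fromBlocks_add, one_add_one_eq_two]; simp
      intro k l
      refine Fin.cases ?_ (fun k => ?_) k <;> refine Fin.cases ?_ (fun l => ?_) l
      · simp [W, fromBlocks_multiply, h2, one_add_one_eq_two]
      · simp [W, fromBlocks_multiply, fromBlocks_add, (Fin.succ_ne_zero l).symm]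
      · simp [W, fromBlocks_multiply, fromBlocks_add, (Fin.succ_ne_zero k)]
      · simp only [W, Fin.cons_succ, fromBlocks_multiply, fromBlocks_add, Fin.succ_inj]
        simp only [mul_zero, zero_mul, add_zero, zero_add, neg_mul_neg, hac]
        split_ifs <;> simp [h2]
    refine ⟨fun k => f (W k), fun k => ?_, fun k l => ?_⟩
    · simp only [f, coe_reindexAlgEquiv, conjTranspose_reindex, hW]
    · rw [← map_mul, ← map_mul, ← map_add, hWac]
      split_ifs
      · exact map_ofNat f 2
      · exact map_zero f

/-- The first `L` terms of the convolution with `g` form a lower triangular Toeplitz operator of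
norm at most `c`. -/
def ToeplitzBound {G : Type*} [NormedAddCommGroup G] [InnerProductSpace ℂ G] (L : ℕ) (g : ℕ → G)
    (c : ℝ) : Prop :=
  ∀ x : ℕ → ℂ, ∑ i ∈ range L, ‖∑ q ∈ antidiagonal i, x q.2 • g q.1‖ ^ 2 ≤
    c ^ 2 * ∑ i ∈ range L, ‖x i‖ ^ 2

theorem ToeplitzBound.mono {G : Type*} [NormedAddCommGroup G] [InnerProductSpace ℂ G] {L : ℕ}
    {g : ℕ → G} {c c' : ℝ} (h : ToeplitzBound L g c) (hc : 0 ≤ c) (hcc : c ≤ c') :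
    ToeplitzBound L g c' := fun x => (h x).trans (by gcongr)

theorem ToeplitzBound.exists_succ {G : Type*} [NormedAddCommGroup G] [InnerProductSpace ℂ G]
    [FiniteDimensional ℂ G] {L : ℕ} {g : ℕ → G} {a b : ℝ} (h : ToeplitzBound L g a) (ha : 0 ≤ a)
    (hab : a < b) : ∃ g' : ℕ → G, (∀ j < L, g' j = g j) ∧ ToeplitzBound (L + 1) g' b := by
  let ex : EuclideanSpace ℂ (Fin L) →ₗ[ℂ] (ℕ → ℂ) :=
    { toFun := fun v s => if hs : s < L then v ⟨s, hs⟩ else 0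
      map_add' := by intro v w; ext s; by_cases hs : s < L <;> simp [hs]
      map_smul' := by intro v w; ext s; by_cases hs : s < L <;> simp [hs] }
  let sh : (ℕ → ℂ) →ₗ[ℂ] (ℕ → ℂ) :=
    { toFun := fun x s => match s with
        | 0 => 0
        | s + 1 => x s
      map_add' := by intro v w; ext s; cases s <;> simp
      map_smul' := by intro v w; ext s; cases s <;> simp }
  let cv : ℕ → (ℕ → ℂ) →ₗ[ℂ] G := fun i =>
    { toFun := fun x => ∑ q ∈ antidiagonal i, x q.2 • g q.1
      map_add' := by intro v w; simp [add_smul, sum_add_distrib]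
      map_smul' := by intro v w; simp [mul_smul, smul_sum] }
  have hsh0 : ∀ x, cv 0 (sh x) = 0 := by intro x; simp [cv, sh]
  have hshS : ∀ i x, cv (i + 1) (sh x) = cv i x := by
    intro i x
    simp only [cv, LinearMap.coe_mk, AddHom.coe_mk, Finset.Nat.antidiagonal_succ', sum_cons,
      sum_map]
    simp [sh]
  have hexn : ∀ v, ∑ i ∈ range L, ‖ex v i‖ ^ 2 = ‖v‖ ^ 2 := by
    intro v
    rw [EuclideanSpace.norm_sq_eq, sum_range]
    simp [ex]
  have hcv : ∀ x, ∑ i ∈ range L, ‖cv i x‖ ^ 2 ≤ a ^ 2 * ∑ i ∈ range L, ‖x i‖ ^ 2 := fun x => h x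
  have hcv_congr : ∀ i ∈ range L, ∀ x y : ℕ → ℂ, (∀ j < L, x j = y j) → cv i x = cv i y := by
    intro i hi x y hxy
    simp only [cv, LinearMap.coe_mk, AddHom.coe_mk]
    refine sum_congr rfl fun q hq => ?_
    rw [hxy]
    have := HasAntidiagonal.mem_antidiagonal.1 hq
    have := mem_range.1 hi
    omega
  let D : EuclideanSpace ℂ (Fin L) →ₗ[ℂ] PiLp 2 (fun _ : Fin L => G) :=
    (WithLp.linearEquiv 2 ℂ (Fin L → G)).symm.toLinearMap ∘ₗ
      LinearMap.pi (fun i : Fin L => cv i ∘ₗ sh ∘ₗ ex)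
  let B : EuclideanSpace ℂ (Fin L) →ₗ[ℂ] G := cv L ∘ₗ sh ∘ₗ ex
  let δ : ℕ → ℂ := Pi.single 0 1
  let C : PiLp 2 (fun _ : Fin L => G) := WithLp.toLp 2 (fun i => cv i δ)
  have hDn : ∀ (t : ℂ) v, ‖t • C + D v‖ ^ 2 = ∑ i ∈ range L, ‖cv i (t • δ + sh (ex v))‖ ^ 2 := by
    intro t v
    rw [PiLp.norm_sq_eq_of_L2, sum_range]
    simp [C, D]
  have hsum : ∀ v, ∑ i ∈ range (L + 1), ‖(δ + sh (ex v)) i‖ ^ 2 = 1 + ‖v‖ ^ 2 := by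
    intro v
    rw [sum_range_succ', ← hexn v]
    simp [δ, sh, add_comm]
  have hcol : ∀ v, ‖B v‖ ^ 2 + ‖D v‖ ^ 2 ≤ a ^ 2 * ‖v‖ ^ 2 := by
    intro v
    have h1 := hDn 0 v
    simp only [zero_smul, zero_add] at h1
    have h2 : ‖B v‖ ^ 2 + ‖D v‖ ^ 2 = ∑ i ∈ range (L + 1), ‖cv i (sh (ex v))‖ ^ 2 := by
      rw [sum_range_succ, h1, add_comm]; rfl
    rw [h2, sum_range_succ', hsh0, ← hexn v]
    simpa [hshS] using hcv (ex v)
  have hrow : ∀ v, ‖C + D v‖ ^ 2 ≤ b ^ 2 * (1 + ‖v‖ ^ 2) := by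
    intro v
    have h1 := hDn 1 v
    rw [one_smul, one_smul] at h1
    rw [h1, ← hsum v]
    refine (hcv _).trans ?_
    gcongr
    exact Nat.le_succ L
  obtain ⟨X, hX⟩ := exists_corner_completion ha hab D B C hcol hrow
  have hX' : ∀ (t : ℂ) v, ‖t • X + B v‖ ^ 2 + ‖t • C + D v‖ ^ 2 ≤
      b ^ 2 * (‖t‖ ^ 2 + ‖v‖ ^ 2) := by
    intro t v
    by_cases ht : t = 0
    · subst ht
      simp only [zero_smul, zero_add, norm_zero]
      refine (hcol v).trans ?_
      have : a ^ 2 ≤ b ^ 2 := by gcongr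
      nlinarith [sq_nonneg ‖v‖]
    · have h1 : t • X + B v = t • (X + B (t⁻¹ • v)) := by
        rw [map_smul, smul_add, smul_inv_smul₀ ht]
      have h2 : t • C + D v = t • (C + D (t⁻¹ • v)) := by
        rw [map_smul, smul_add, smul_inv_smul₀ ht]
      have h3 : ‖v‖ = ‖t‖ * ‖t⁻¹ • v‖ := by
        rw [← norm_smul, smul_inv_smul₀ ht]
      rw [h1, h2, h3, norm_smul, norm_smul]
      nlinarith [hX (t⁻¹ • v), mul_le_mul_of_nonneg_left (hX (t⁻¹ • v)) (sq_nonneg ‖t‖)]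
  refine ⟨Function.update g L X, fun j hj => Function.update_of_ne hj.ne _ _, fun x => ?_⟩
  let v : EuclideanSpace ℂ (Fin L) := WithLp.toLp 2 (fun i => x (i + 1))
  have hx : ∀ i < L + 1, x i = (x 0 • δ + sh (ex v)) i := by
    intro i hi
    cases i with
    | zero => simp [δ, sh]
    | succ i => simp [δ, sh, ex, v, show i < L by omega]
  have hupd : ∀ i, ∑ q ∈ antidiagonal i, x q.2 • Function.update g L X q.1 =
      cv i x + ∑ q ∈ antidiagonal i, x q.2 • (Function.update g L X q.1 - g q.1) := by
    intro i
    simp [cv, smul_sub]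
  have hlt : ∀ i ∈ range L, ∑ q ∈ antidiagonal i, x q.2 • Function.update g L X q.1 =
      cv i (x 0 • δ + sh (ex v)) := by
    intro i hi
    rw [hupd, hcv_congr i hi _ (x 0 • δ + sh (ex v)) fun j hj => hx j (by omega),
      sum_eq_zero, add_zero]
    intro q hq
    have := HasAntidiagonal.mem_antidiagonal.1 hq
    have := mem_range.1 hi
    rw [Function.update_of_ne (by omega), sub_self, smul_zero]
  have hcL : cv L x = x 0 • g L + B v := by
    have h1 : cv L x = cv L (x 0 • δ + sh (ex v)) := by
      simp only [cv, LinearMap.coe_mk, AddHom.coe_mk]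
      refine sum_congr rfl fun q hq => ?_
      rw [hx q.2]
      have := HasAntidiagonal.mem_antidiagonal.1 hq
      omega
    have h2 : cv L δ = g L := by
      simp only [cv, LinearMap.coe_mk, AddHom.coe_mk]
      rw [sum_eq_single (L, 0)]
      · simp [δ]
      · rintro ⟨i, j⟩ hq hne
        have := HasAntidiagonal.mem_antidiagonal.1 hq
        have hj : j ≠ 0 := by
          rintro rfl
          simp at this
          exact hne (by simp [this])
        simp [δ, hj]
      · simp
    rw [h1, map_add, map_smul, h2]
    rfl
  have heq : ∑ q ∈ antidiagonal L, x q.2 • Function.update g L X q.1 = x 0 • X + B v := by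
    rw [hupd, hcL, sum_eq_single (L, 0)]
    · simp only [Function.update_self, smul_sub]; abel
    · rintro ⟨i, j⟩ hq hne
      have := HasAntidiagonal.mem_antidiagonal.1 hq
      have hi : i ≠ L := by
        rintro rfl
        simp at this
        exact hne (by simp [this])
      simp [hi]
    · simp
  rw [sum_range_succ, sum_congr rfl fun i hi => by rw [hlt i hi], ← hDn, heq, add_comm]
  refine (hX' _ _).trans (le_of_eq ?_)
  rw [sum_range_succ', EuclideanSpace.norm_sq_eq, sum_range, add_comm]

theorem ToeplitzBound.exists_extension {G : Type*} [NormedAddCommGroup G] [InnerProductSpace ℂ G]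
    [FiniteDimensional ℂ G] {N : ℕ} {g : ℕ → G} {c : ℝ} (h : ToeplitzBound N g c) (hc : 0 ≤ c)
    (L : ℕ) (hL : N ≤ L) :
    ∀ c' > c, ∃ g' : ℕ → G, (∀ j < N, g' j = g j) ∧ ToeplitzBound L g' c' := by
  induction L, hL using Nat.le_induction with
  | base => exact fun c' hc' => ⟨g, fun _ _ => rfl, h.mono hc hc'.le⟩
  | succ L hL ih =>
    intro c' hc'
    obtain ⟨g₁, h₁, hb⟩ := ih ((c + c') / 2) (by linarith)
    obtain ⟨g₂, h₂, hb'⟩ := hb.exists_succ (b := c') (by linarith) (by linarith)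
    exact ⟨g₂, fun j hj => (h₂ j (by omega)).trans (h₁ j hj), hb'⟩

theorem ToeplitzBound.norm_fejer_le {G : Type*} [NormedAddCommGroup G] [InnerProductSpace ℂ G]
    {L : ℕ} {g : ℕ → G} {c : ℝ} (h : ToeplitzBound L g c) (hc : 0 ≤ c) (hL : 0 < L) {z : ℂ}
    (hz : ‖z‖ = 1) : ‖∑ l ∈ range L, z ^ l • (1 - (l : ℂ) / L) • g l‖ ≤ c := by
  have hz0 : z ≠ 0 := norm_ne_zero_iff.1 (by simp [hz])
  have hL0 : (L : ℂ) ≠ 0 := by exact_mod_cast hL.ne'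
  have hLr : (0 : ℝ) < L := by exact_mod_cast hL
  let O : ℕ → G := fun i => ∑ q ∈ antidiagonal i, z⁻¹ ^ q.2 • g q.1
  have hO : ∀ i, z ^ i • O i = ∑ j ∈ range (i + 1), z ^ j • g j := by
    intro i
    rw [← Finset.Nat.sum_antidiagonal_eq_sum_range_succ_mk (f := fun q : ℕ × ℕ => z ^ q.1 • g q.1),
      smul_sum]
    refine sum_congr rfl fun q hq => ?_
    rw [← HasAntidiagonal.mem_antidiagonal.1 hq, smul_smul, pow_add, inv_pow,
      mul_inv_cancel_right₀ (pow_ne_zero _ hz0)]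
  have hsum : ∑ i ∈ range L, z ^ i • O i =
      (L : ℂ) • ∑ l ∈ range L, z ^ l • (1 - (l : ℂ) / L) • g l := by
    clear h hL hL0 hLr
    have h1 : ∀ M : ℕ, ∑ i ∈ range M, z ^ i • O i =
        ∑ l ∈ range M, ((M : ℂ) - l) • z ^ l • g l := by
      intro M
      induction M with
      | zero => simp
      | succ M ih =>
        rw [sum_range_succ, ih, hO, sum_range_succ, sum_range_succ _ M, ← add_assoc,
          ← sum_add_distrib]
        congr 1
        · refine sum_congr rfl fun l _ => ?_
          push_cast
          module
        · push_cast
          module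
    rcases Nat.eq_zero_or_pos L with rfl | hL
    · simp
    have hL0 : (L : ℂ) ≠ 0 := by exact_mod_cast hL.ne'
    rw [h1, smul_sum]
    refine sum_congr rfl fun l _ => ?_
    rw [smul_smul, smul_smul, smul_smul]
    congr 1
    field_simp
  have h1 : ∑ i ∈ range L, ‖O i‖ ^ 2 ≤ c ^ 2 * L := by
    refine (h fun s => z⁻¹ ^ s).trans ?_
    simp [hz]
  have h2 : (∑ i ∈ range L, ‖O i‖) ^ 2 ≤ L * ∑ i ∈ range L, ‖O i‖ ^ 2 := by
    simpa using sq_sum_le_card_mul_sum_sq (s := range L) (f := fun i => ‖O i‖)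
  have h3 : ‖∑ i ∈ range L, z ^ i • O i‖ ≤ ∑ i ∈ range L, ‖O i‖ := by
    refine (norm_sum_le _ _).trans (le_of_eq ?_)
    simp [norm_smul, hz]
  rw [hsum, norm_smul, Complex.norm_natCast] at h3
  have h4 : ∑ i ∈ range L, ‖O i‖ ≤ L * c :=
    abs_le_of_sq_le_sq' (by nlinarith) (by positivity) |>.2
  exact le_of_mul_le_mul_left (h3.trans h4) hLr

theorem ToeplitzBound.sum_norm_sq_le {G H H' : Type*} [NormedAddCommGroup G]
    [InnerProductSpace ℂ G] [FiniteDimensional ℂ G] [NormedAddCommGroup H] [InnerProductSpace ℂ H]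
    [NormedAddCommGroup H'] [InnerProductSpace ℂ H'] {N : ℕ} {g : ℕ → G} {c γ : ℝ}
    (h : ToeplitzBound N g c) (hc : 0 ≤ c) (hγ : 0 ≤ γ) (Φ : G →ₗ[ℂ] H →ₗ[ℂ] H')
    (hΦ : ∀ a v, ‖Φ a v‖ ≤ γ * ‖a‖ * ‖v‖) (x : ℕ → H) :
    ∑ i ∈ range N, ‖∑ q ∈ antidiagonal i, Φ (g q.1) (x q.2)‖ ^ 2 ≤
      (γ * c) ^ 2 * ∑ i ∈ range N, ‖x i‖ ^ 2 := by
  have key : ∀ L : ℕ, N + 1 ≤ L →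
      ∑ i ∈ range N, ‖∑ q ∈ antidiagonal i, (1 - (q.1 : ℂ) / L) • Φ (g q.1) (x q.2)‖ ^ 2 ≤
        (γ * (c + 1 / L)) ^ 2 * ∑ i ∈ range N, ‖x i‖ ^ 2 := by
    intro L hL
    have hLr : (0 : ℝ) < L := by exact_mod_cast (by omega : 0 < L)
    obtain ⟨g', hg', hb⟩ := h.exists_extension hc L (by omega) (c + 1 / L)
      (by have := one_div_pos.2 hLr; linarith)
    let B : ℕ → H →ₗ[ℂ] H' := fun l => if l < L then Φ ((1 - (l : ℂ) / L) • g' l) else 0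
    have h1 := sum_norm_sq_antidiagonal_le (L := L) (c := γ * (c + 1 / L)) B ?_ ?_ N x
    · refine le_trans (le_of_eq ?_) h1
      refine sum_congr rfl fun i hi => ?_
      congr 2
      refine sum_congr rfl fun q hq => ?_
      have := HasAntidiagonal.mem_antidiagonal.1 hq
      have := mem_range.1 hi
      simp [B, show q.1 < L by omega, hg' q.1 (by omega)]
    · intro z hz v
      have h2 : ∑ l ∈ range L, z ^ l • B l v =
          Φ (∑ l ∈ range L, z ^ l • (1 - (l : ℂ) / L) • g' l) v := by
        rw [map_sum, LinearMap.sum_apply]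
        refine sum_congr rfl fun l hl => ?_
        simp [B, mem_range.1 hl]
      rw [h2]
      refine (hΦ _ _).trans ?_
      gcongr
      exact hb.norm_fejer_le (by positivity) (by omega) hz
    · intro l hl
      simp [B, not_lt.2 hl]
  have hinv : Filter.Tendsto (fun L : ℕ => (1 : ℝ) / L) Filter.atTop (nhds 0) :=
    tendsto_one_div_atTop_nhds_zero_nat
  have hlim : ∀ j : ℕ, Filter.Tendsto (fun L : ℕ => (1 : ℂ) - (j : ℂ) / L) Filter.atTop
      (nhds 1) := by
    intro j
    simpa using tendsto_const_nhds.sub (tendsto_const_div_atTop_nhds_zero_nat (j : ℂ))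
  refine le_of_tendsto_of_tendsto (b := Filter.atTop)
    (f := fun L : ℕ => ∑ i ∈ range N,
      ‖∑ q ∈ antidiagonal i, (1 - (q.1 : ℂ) / L) • Φ (g q.1) (x q.2)‖ ^ 2)
    (g := fun L : ℕ => (γ * (c + 1 / L)) ^ 2 * ∑ i ∈ range N, ‖x i‖ ^ 2) ?_ ?_ ?_
  · refine tendsto_finsetSum _ fun i _ => Filter.Tendsto.pow (Filter.Tendsto.norm ?_) 2
    refine tendsto_finsetSum _ fun q _ => ?_
    simpa using (hlim q.1).smul_const (Φ (g q.1) (x q.2))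
  · have := ((hinv.const_add c).const_mul γ).pow 2
    rw [add_zero] at this
    exact this.mul_const _
  · filter_upwards [Filter.eventually_ge_atTop (N + 1)] with L hL using key L hL

theorem sum_norm_sq_coeff_smul_le {H : Type*} [NormedAddCommGroup H] [InnerProductSpace ℂ H]
    {p : Polynomial ℂ} {M : ℝ} (hp : ∀ z : ℂ, ‖z‖ = 1 → ‖p.eval z‖ ≤ M) (N : ℕ) (x : ℕ → H) :
    ∑ i ∈ range N, ‖∑ q ∈ antidiagonal i, p.coeff q.1 • x q.2‖ ^ 2 ≤
      M ^ 2 * ∑ i ∈ range N, ‖x i‖ ^ 2 := by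
  refine sum_norm_sq_antidiagonal_le (L := p.natDegree + 1)
    (fun l => p.coeff l • (LinearMap.id : H →ₗ[ℂ] H)) (fun z hz v => ?_) (fun l hl => ?_) N x
  · have : ∑ l ∈ range (p.natDegree + 1), z ^ l • (p.coeff l • (LinearMap.id : H →ₗ[ℂ] H)) v =
        p.eval z • v := by
      rw [Polynomial.eval_eq_sum_range, sum_smul]
      refine sum_congr rfl fun l _ => ?_
      simp [smul_smul, mul_comm]
    rw [this, norm_smul]
    gcongr
    exact hp z hz
  · simp [Polynomial.coeff_eq_zero_of_natDegree_lt hl]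

theorem sum_sq_div_four_pow_le (t m : ℕ) :
    ∑ k ∈ range m, (if t ≤ 2 ^ k then (t : ℝ) ^ 2 / 4 ^ k else 0) ≤ 4 / 3 := by
  have key : (t ≤ 2 ^ m → ∑ k ∈ range m, (if t ≤ 2 ^ k then (t : ℝ) ^ 2 / 4 ^ k else 0) ≤
      4 / 3 - 4 / 3 * ((t : ℝ) ^ 2 / 4 ^ m)) ∧
      (2 ^ m < t → ∑ k ∈ range m, (if t ≤ 2 ^ k then (t : ℝ) ^ 2 / 4 ^ k else 0) = 0) := by
    induction m with
    | zero =>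
      refine ⟨fun ht => ?_, fun _ => by simp⟩
      have : (t : ℝ) ≤ 1 := by exact_mod_cast ht
      have h0 : (0 : ℝ) ≤ t := by positivity
      simp
      nlinarith
    | succ m ih =>
      rw [sum_range_succ]
      refine ⟨fun ht => ?_, fun ht => ?_⟩
      · have h4 : (t : ℝ) ^ 2 / 4 ^ (m + 1) = (t : ℝ) ^ 2 / 4 ^ m / 4 := by
          rw [div_div, ← pow_succ]
        by_cases h : t ≤ 2 ^ m
        · have := ih.1 h
          rw [if_pos h, h4]
          linarith
        · rw [ih.2 (by omega), if_neg h]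
          have h1 : (t : ℝ) ≤ 2 ^ (m + 1) := by exact_mod_cast ht
          have h2 : (t : ℝ) ^ 2 / 4 ^ (m + 1) ≤ 1 := by
            rw [div_le_one (by positivity)]
            calc (t : ℝ) ^ 2 ≤ (2 ^ (m + 1)) ^ 2 := by gcongr
              _ = 4 ^ (m + 1) := by rw [← pow_mul, mul_comm, pow_mul]; norm_num
          linarith
      · have : 2 ^ m < 2 ^ (m + 1) := Nat.pow_lt_pow_right (by norm_num) (by omega)
        rw [ih.2 (by omega), if_neg (by omega), add_zero]
  rcases le_or_gt t (2 ^ m) with h | h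
  · have := key.1 h
    have h0 : (0 : ℝ) ≤ (t : ℝ) ^ 2 / 4 ^ m := by positivity
    linarith
  · rw [key.2 h]; norm_num

theorem sum_norm_sq_deriv_coeff_le {p : Polynomial ℂ} {M : ℝ}
    (hp : ∀ z : ℂ, ‖z‖ = 1 → ‖p.eval z‖ ≤ M) (m N : ℕ) (hN : ∀ k < m, 2 ^ k < N) (x : ℕ → ℂ) :
    ∑ k ∈ range m, ∑ t ∈ range (2 ^ k + 1),
      ‖(2 ^ k : ℂ)⁻¹ * ∑ q ∈ antidiagonal t, (q.1 : ℂ) * p.coeff q.1 * x q.2‖ ^ 2 ≤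
      16 / 3 * M ^ 2 * ∑ s ∈ range N, ‖x s‖ ^ 2 := by
  let u : ℕ → ℂ := fun t => ∑ q ∈ antidiagonal t, p.coeff q.1 • x q.2
  let w : ℕ → ℂ := fun t => ∑ q ∈ antidiagonal t, p.coeff q.1 • ((q.2 : ℂ) * x q.2)
  have hv : ∀ t : ℕ, ∑ q ∈ antidiagonal t, (q.1 : ℂ) * p.coeff q.1 * x q.2 = t * u t - w t := by
    intro t
    simp only [u, w, mul_sum, ← sum_sub_distrib]
    refine sum_congr rfl fun q hq => ?_
    rw [← HasAntidiagonal.mem_antidiagonal.1 hq]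
    push_cast
    simp only [smul_eq_mul]
    ring
  have hswap : ∀ f : ℕ → ℝ, (∀ t, 0 ≤ f t) →
      ∑ k ∈ range m, ∑ t ∈ range (2 ^ k + 1), (t : ℝ) ^ 2 / 4 ^ k * f t ≤
      4 / 3 * ∑ t ∈ range N, f t := by
    intro f hf
    calc ∑ k ∈ range m, ∑ t ∈ range (2 ^ k + 1), (t : ℝ) ^ 2 / 4 ^ k * f t
        = ∑ k ∈ range m, ∑ t ∈ range N, (if t ≤ 2 ^ k then (t : ℝ) ^ 2 / 4 ^ k else 0) * f t := by
          refine sum_congr rfl fun k hk => ?_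
          have hk := hN k (mem_range.1 hk)
          simp only [ite_mul, zero_mul]
          rw [← sum_filter]
          refine sum_congr ?_ fun _ _ => rfl
          ext t
          simp only [mem_range, mem_filter]
          omega
      _ = ∑ t ∈ range N, (∑ k ∈ range m, if t ≤ 2 ^ k then (t : ℝ) ^ 2 / 4 ^ k else 0) * f t := by
          rw [sum_comm]
          simp_rw [sum_mul]
      _ ≤ 4 / 3 * ∑ t ∈ range N, f t := by
          rw [mul_sum]
          refine sum_le_sum fun t _ => ?_
          exact mul_le_mul_of_nonneg_right (sum_sq_div_four_pow_le t m) (hf t)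
  have hterm : ∀ k t, ‖(2 ^ k : ℂ)⁻¹ * (t * u t - w t)‖ ^ 2 ≤
      2 * ((t : ℝ) ^ 2 / 4 ^ k * ‖u t‖ ^ 2) + 2 * (((4 : ℝ) ^ k)⁻¹ * ‖w t‖ ^ 2) := by
    intro k t
    have h1 : ‖(2 ^ k : ℂ)⁻¹ * (t * u t - w t)‖ ^ 2 = ((4 : ℝ) ^ k)⁻¹ * ‖t * u t - w t‖ ^ 2 := by
      rw [norm_mul, mul_pow]
      congr 1
      rw [norm_inv, norm_pow, inv_pow, ← pow_mul, mul_comm, pow_mul]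
      norm_num
    have h2 : ‖t * u t - w t‖ ≤ t * ‖u t‖ + ‖w t‖ := by
      refine (norm_sub_le _ _).trans ?_
      simp
    have h3 : ‖t * u t - w t‖ ^ 2 ≤ 2 * ((t : ℝ) ^ 2 * ‖u t‖ ^ 2) + 2 * ‖w t‖ ^ 2 := by
      have := pow_le_pow_left₀ (norm_nonneg _) h2 2
      nlinarith [sq_nonneg (t * ‖u t‖ - ‖w t‖)]
    rw [h1]
    calc ((4 : ℝ) ^ k)⁻¹ * ‖t * u t - w t‖ ^ 2
        ≤ ((4 : ℝ) ^ k)⁻¹ * (2 * ((t : ℝ) ^ 2 * ‖u t‖ ^ 2) + 2 * ‖w t‖ ^ 2) := by gcongr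
      _ = _ := by rw [div_eq_mul_inv]; ring
  have hw : ∀ k, ∑ t ∈ range (2 ^ k + 1), ((4 : ℝ) ^ k)⁻¹ * ‖w t‖ ^ 2 ≤
      M ^ 2 * ∑ t ∈ range (2 ^ k + 1), (t : ℝ) ^ 2 / 4 ^ k * ‖x t‖ ^ 2 := by
    intro k
    rw [← mul_sum]
    have h1 := sum_norm_sq_coeff_smul_le hp (2 ^ k + 1) fun s => (s : ℂ) * x s
    calc ((4 : ℝ) ^ k)⁻¹ * ∑ t ∈ range (2 ^ k + 1), ‖w t‖ ^ 2
        ≤ ((4 : ℝ) ^ k)⁻¹ * (M ^ 2 * ∑ t ∈ range (2 ^ k + 1), ‖(t : ℂ) * x t‖ ^ 2) := by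
          gcongr
      _ = _ := by
          rw [mul_left_comm, mul_sum _ _ (((4 : ℝ) ^ k)⁻¹)]
          congr 1
          refine sum_congr rfl fun t _ => ?_
          rw [norm_mul, mul_pow, Complex.norm_natCast]
          ring
  have hu := sum_norm_sq_coeff_smul_le hp N x
  have h1 := hswap (fun t => ‖u t‖ ^ 2) fun t => by positivity
  have h2 := hswap (fun t => ‖x t‖ ^ 2) fun t => by positivity
  calc _ ≤ ∑ k ∈ range m, ∑ t ∈ range (2 ^ k + 1), (2 * ((t : ℝ) ^ 2 / 4 ^ k * ‖u t‖ ^ 2) +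
        2 * (((4 : ℝ) ^ k)⁻¹ * ‖w t‖ ^ 2)) := by
        refine sum_le_sum fun k _ => sum_le_sum fun t _ => ?_
        rw [hv]
        exact hterm k t
    _ = 2 * (∑ k ∈ range m, ∑ t ∈ range (2 ^ k + 1), (t : ℝ) ^ 2 / 4 ^ k * ‖u t‖ ^ 2) +
        2 * ∑ k ∈ range m, ∑ t ∈ range (2 ^ k + 1), ((4 : ℝ) ^ k)⁻¹ * ‖w t‖ ^ 2 := by
        simp only [sum_add_distrib, mul_sum]
    _ ≤ 2 * (4 / 3 * (M ^ 2 * ∑ s ∈ range N, ‖x s‖ ^ 2)) +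
        2 * (M ^ 2 * (4 / 3 * ∑ s ∈ range N, ‖x s‖ ^ 2)) := by
        gcongr
        · exact h1.trans (by gcongr)
        · refine (sum_le_sum fun k _ => hw k).trans ?_
          rw [← mul_sum]
          gcongr
    _ = _ := by ring

/-- The symbol of the off-diagonal block of `p(R)`. -/
noncomputable def lacunarySymbol (m : ℕ) (p : Polynomial ℂ) (j : ℕ) :
    EuclideanSpace ℂ (Fin (m + 1)) :=
  WithLp.toLp 2 fun k => if 2 ^ m ≤ j + 1 + 2 ^ (k : ℕ) then
    (2 ^ (k : ℕ) : ℂ)⁻¹ * (((j + 1 + 2 ^ (k : ℕ) - 2 ^ m : ℕ) : ℂ) *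
      p.coeff (j + 1 + 2 ^ (k : ℕ) - 2 ^ m)) else 0

theorem toeplitzBound_lacunarySymbol (m : ℕ) {p : Polynomial ℂ} {M : ℝ}
    (hp : ∀ z : ℂ, ‖z‖ = 1 → ‖p.eval z‖ ≤ M) :
    ToeplitzBound (2 ^ m) (lacunarySymbol m p) (7 / 3 * M) := by
  intro x₀
  set N := 2 ^ m with hNdef
  let x := Function.update x₀ N 0
  have hx : ∀ i < N, x i = x₀ i := fun i hi => Function.update_of_ne hi.ne _ _
  have hxN : x N = 0 := Function.update_self _ _ _
  have h1 : ∀ i ∈ range N, ∑ q ∈ antidiagonal i, x₀ q.2 • lacunarySymbol m p q.1 =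
      ∑ q ∈ antidiagonal i, x q.2 • lacunarySymbol m p q.1 := by
    intro i hi
    refine sum_congr rfl fun q hq => ?_
    have := HasAntidiagonal.mem_antidiagonal.1 hq
    have := mem_range.1 hi
    rw [hx _ (by omega)]
  rw [sum_congr rfl fun i hi => by rw [h1 i hi],
    ← sum_congr rfl fun i hi => congrArg (fun y : ℂ => ‖y‖ ^ 2) (hx i (mem_range.1 hi))]
  have hmain := sum_norm_sq_deriv_coeff_le hp (m + 1) (N + 1) (fun k hk => by
    have : 2 ^ k ≤ 2 ^ m := Nat.pow_le_pow_right (by norm_num) (by omega)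
    omega) x
  rw [sum_range_succ _ N, hxN] at hmain
  simp_rw [EuclideanSpace.norm_sq_eq (𝕜 := ℂ) (n := Fin (m + 1))]
  rw [sum_comm]
  have h2 : ∀ k : Fin (m + 1), ∑ i ∈ range N,
      ‖(∑ q ∈ antidiagonal i, x q.2 • lacunarySymbol m p q.1) k‖ ^ 2 ≤
      ∑ t ∈ range (2 ^ (k : ℕ) + 1),
      ‖(2 ^ (k : ℕ) : ℂ)⁻¹ * ∑ q ∈ antidiagonal t, (q.1 : ℂ) * p.coeff q.1 * x q.2‖ ^ 2 := by
    intro k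
    have hk : 2 ^ (k : ℕ) ≤ N := Nat.pow_le_pow_right (by norm_num) (by omega)
    set n := 2 ^ (k : ℕ) with hn
    set V : ℕ → ℂ := fun t =>
      (2 ^ (k : ℕ) : ℂ)⁻¹ * ∑ q ∈ antidiagonal t, (q.1 : ℂ) * p.coeff q.1 * x q.2 with hV
    have h3 : ∀ i ∈ range N, (∑ q ∈ antidiagonal i, x q.2 • lacunarySymbol m p q.1) k =
        if N ≤ i + 1 + n then V (i + 1 + n - N) else 0 := by
      intro i hi
      have h4 : (∑ q ∈ antidiagonal i, x q.2 • lacunarySymbol m p q.1) k =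
          ∑ s ∈ range (i + 1), x s * lacunarySymbol m p (i - s) k := by
        rw [← Finset.Nat.sum_antidiagonal_eq_sum_range_succ_mk
          (f := fun q : ℕ × ℕ => x q.1 * lacunarySymbol m p q.2 k),
          ← Finset.Nat.sum_antidiagonal_swap]
        simp
      rw [h4]
      split_ifs with h
      · obtain ⟨t, ht⟩ : ∃ t, i + 1 + n - N = t := ⟨_, rfl⟩
        have h5 : V t = ∑ s ∈ range t, (2 ^ (k : ℕ) : ℂ)⁻¹ *
            (((t - s : ℕ) : ℂ) * p.coeff (t - s) * x s) := by
          simp only [hV]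
          rw [← Finset.Nat.sum_antidiagonal_swap, Finset.Nat.sum_antidiagonal_eq_sum_range_succ_mk,
            sum_range_succ, mul_add, mul_sum]
          simp
        rw [ht, h5]
        symm
        have h6 : ∀ s ∈ range t, (2 ^ (k : ℕ) : ℂ)⁻¹ *
            (((t - s : ℕ) : ℂ) * p.coeff (t - s) * x s) =
            x s * lacunarySymbol m p (i - s) k := by
          intro s hs
          have := mem_range.1 hs
          simp only [lacunarySymbol, ← hNdef, ← hn]
          rw [if_pos (by omega), show i - s + 1 + n - N = t - s by omega]
          ring
        rw [sum_congr rfl h6]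
        refine sum_subset (range_subset_range.2 (by omega)) fun s hs hs' => ?_
        simp only [mem_range] at hs hs'
        simp only [lacunarySymbol, ← hNdef, ← hn]
        rw [show i - s + 1 + n - N = 0 by omega]
        simp
      · refine sum_eq_zero fun s hs => ?_
        simp only [lacunarySymbol, ← hNdef, ← hn]
        rw [if_neg (by omega), mul_zero]
    calc _ = ∑ i ∈ range N, if N ≤ i + 1 + n then ‖V (i + 1 + n - N)‖ ^ 2 else 0 := by
          refine sum_congr rfl fun i hi => ?_
          rw [h3 i hi]
          split_ifs <;> simp
      _ = ∑ i ∈ (range N).filter (fun i => N ≤ i + 1 + n), ‖V (i + 1 + n - N)‖ ^ 2 := by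
          rw [sum_filter]
      _ = ∑ t ∈ ((range N).filter (fun i => N ≤ i + 1 + n)).image (fun i => i + 1 + n - N),
          ‖V t‖ ^ 2 := by
          rw [sum_image]
          intro i hi j hj hij
          simp only [coe_filter, mem_range, Set.mem_ofPred_eq] at hi hj hij
          omega
      _ ≤ _ := by
          refine sum_le_sum_of_subset_of_nonneg (fun t ht => ?_) fun _ _ _ => by positivity
          simp only [mem_image, mem_filter, mem_range] at ht ⊢
          omega
  refine (sum_le_sum fun k _ => h2 k).trans ?_
  rw [← sum_range (fun k => ∑ t ∈ range (2 ^ k + 1),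
      ‖(2 ^ k : ℂ)⁻¹ * ∑ q ∈ antidiagonal t, (q.1 : ℂ) * p.coeff q.1 * x q.2‖ ^ 2)]
  refine hmain.trans ?_
  have h0 : 0 ≤ ∑ i ∈ range N, ‖x i‖ ^ 2 := sum_nonneg fun _ _ => by positivity
  simp only [norm_zero]
  nlinarith [mul_nonneg (sq_nonneg M) h0]

section Model

variable {H : Type*} [NormedAddCommGroup H] [InnerProductSpace ℂ H]

/-- The `i`-th coordinate of a vector in the `N`-fold Hilbert sum, extended by zero. -/
noncomputable def coord (N : ℕ) (i : ℕ) : PiLp 2 (fun _ : Fin N => H) →ₗ[ℂ] H :=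
  if h : i < N then LinearMap.proj (⟨i, h⟩ : Fin N) ∘ₗ
    (WithLp.linearEquiv 2 ℂ (Fin N → H)).toLinearMap else 0

/-- The nilpotent unilateral shift on the `N`-fold Hilbert sum. -/
noncomputable def shift (N : ℕ) :
    PiLp 2 (fun _ : Fin N => H) →ₗ[ℂ] PiLp 2 (fun _ : Fin N => H) :=
  (WithLp.linearEquiv 2 ℂ (Fin N → H)).symm.toLinearMap ∘ₗ
    LinearMap.pi fun i => if (i : ℕ) = 0 then 0 else coord N ((i : ℕ) - 1)

/-- The operator acting as `A` on each summand. -/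
noncomputable def ampliation (N : ℕ) (A : H →ₗ[ℂ] H) :
    PiLp 2 (fun _ : Fin N => H) →ₗ[ℂ] PiLp 2 (fun _ : Fin N => H) :=
  (WithLp.linearEquiv 2 ℂ (Fin N → H)).symm.toLinearMap ∘ₗ
    LinearMap.pi fun i => A ∘ₗ coord N i

theorem coord_of_lt {N i : ℕ} (h : i < N) (x : PiLp 2 (fun _ : Fin N => H)) :
    coord N i x = x ⟨i, h⟩ := by simp [coord, h]

theorem coord_shift {N i : ℕ} (h : i < N) (x : PiLp 2 (fun _ : Fin N => H)) :
    coord N i (shift N x) = if i = 0 then 0 else coord N (i - 1) x := by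
  rw [coord_of_lt h]
  simp only [shift, LinearMap.comp_apply, LinearEquiv.coe_coe, WithLp.coe_symm_linearEquiv,
    LinearMap.pi_apply]
  split_ifs <;> simp

theorem coord_ampliation {N i : ℕ} (h : i < N) (A : H →ₗ[ℂ] H)
    (x : PiLp 2 (fun _ : Fin N => H)) : coord N i (ampliation N A x) = A (coord N i x) := by
  rw [coord_of_lt h]
  simp [ampliation]

theorem ext_coord {N : ℕ} {x y : PiLp 2 (fun _ : Fin N => H)}
    (h : ∀ i < N, coord N i x = coord N i y) : x = y := by
  ext i
  have := h i i.2
  rwa [coord_of_lt i.2, coord_of_lt i.2] at this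

theorem norm_sq_eq_sum_coord {N : ℕ} (x : PiLp 2 (fun _ : Fin N => H)) :
    ‖x‖ ^ 2 = ∑ i ∈ range N, ‖coord N i x‖ ^ 2 := by
  rw [PiLp.norm_sq_eq_of_L2, sum_range]
  refine sum_congr rfl fun i _ => ?_
  rw [coord_of_lt i.2]

theorem coord_shift_pow {N : ℕ} (l : ℕ) {i : ℕ} (h : i < N) (x : PiLp 2 (fun _ : Fin N => H)) :
    coord N i ((shift N ^ l) x) = if l ≤ i then coord N (i - l) x else 0 := by
  induction l generalizing i with
  | zero => simp
  | succ l ih =>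
    rw [pow_succ', Module.End.mul_apply, coord_shift h]
    rcases Nat.eq_zero_or_pos i with rfl | hi
    · simp
    · rw [if_neg hi.ne', ih (by omega)]
      by_cases hl : l + 1 ≤ i
      · rw [if_pos hl, if_pos (by omega), show i - 1 - l = i - (l + 1) by omega]
      · rw [if_neg hl, if_neg (by omega)]

theorem coord_aeval_shift {N : ℕ} (p : Polynomial ℂ) {i : ℕ} (h : i < N)
    (x : PiLp 2 (fun _ : Fin N => H)) :
    coord N i (Polynomial.aeval (shift N) p x) =
      ∑ q ∈ antidiagonal i, p.coeff q.1 • coord N q.2 x := by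
  induction p using Polynomial.induction_on' with
  | add p q hp hq => simp [add_smul, sum_add_distrib, hp, hq]
  | monomial l a =>
    rw [Polynomial.aeval_monomial, Finset.Nat.sum_antidiagonal_eq_sum_range_succ_mk]
    simp only [Module.End.mul_apply, Module.algebraMap_end_apply, map_smul, coord_shift_pow l h,
      Polynomial.coeff_monomial, ite_smul, zero_smul, smul_ite, smul_zero]
    rw [sum_ite_eq]
    simp

theorem shift_ampliation_commute {N : ℕ} (A : H →ₗ[ℂ] H) :
    Commute (shift N) (ampliation N A) := by
  refine LinearMap.ext fun x => ext_coord fun i hi => ?_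
  simp only [Module.End.mul_apply]
  rw [coord_shift hi, coord_ampliation hi, coord_shift hi]
  split_ifs
  · simp
  · rw [coord_ampliation (by omega)]

/-- The lacunary off-diagonal entry. -/
noncomputable def lacunaryOp (m : ℕ) (A : Fin (m + 1) → H →ₗ[ℂ] H) :
    PiLp 2 (fun _ : Fin (2 ^ m) => H) →ₗ[ℂ] PiLp 2 (fun _ : Fin (2 ^ m) => H) :=
  ∑ k : Fin (m + 1), (2 ^ (k : ℕ) : ℂ)⁻¹ •
    (shift (2 ^ m) ^ (2 ^ m - 2 ^ (k : ℕ)) * ampliation (2 ^ m) (A k))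

theorem shift_lacunaryOp_commute (m : ℕ) (A : Fin (m + 1) → H →ₗ[ℂ] H) :
    Commute (shift (2 ^ m)) (lacunaryOp m A) := by
  refine Commute.sum_right _ _ _ fun k _ => Commute.smul_right ?_ _
  exact ((Commute.refl _).pow_right _).mul_right (shift_ampliation_commute _)

/-- The operator `a ↦ ∑ aₖ Aₖ` attached to a family of operators. -/
noncomputable def familyMap {κ : Type*} [Fintype κ] (A : κ → H →ₗ[ℂ] H) :
    EuclideanSpace ℂ κ →ₗ[ℂ] H →ₗ[ℂ] H where
  toFun a := ∑ k, a k • A k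
  map_add' a b := by simp [add_smul, sum_add_distrib]
  map_smul' t a := by simp [mul_smul, smul_sum]

theorem coord_aeval_derivative_lacunaryOp (m : ℕ) (A : Fin (m + 1) → H →ₗ[ℂ] H)
    (p : Polynomial ℂ) {i : ℕ} (hi : i < 2 ^ m) (x : PiLp 2 (fun _ : Fin (2 ^ m) => H)) :
    coord (2 ^ m) i (Polynomial.aeval (shift (2 ^ m)) (Polynomial.derivative p)
      (lacunaryOp m A x)) =
      ∑ q ∈ antidiagonal i, familyMap A (lacunarySymbol m p q.1) (coord (2 ^ m) q.2 x) := by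
  have h1 : Polynomial.aeval (shift (2 ^ m)) (Polynomial.derivative p) (lacunaryOp m A x) =
      ∑ k : Fin (m + 1), (2 ^ (k : ℕ) : ℂ)⁻¹ • Polynomial.aeval (shift (2 ^ m))
        (Polynomial.derivative p * Polynomial.X ^ (2 ^ m - 2 ^ (k : ℕ)))
        (ampliation (2 ^ m) (A k) x) := by
    simp [lacunaryOp, LinearMap.sum_apply]
  rw [h1, map_sum]
  simp only [map_smul]
  simp only [coord_aeval_shift _ hi, smul_sum]
  rw [sum_comm]
  refine sum_congr rfl fun q hq => ?_
  simp only [familyMap, LinearMap.coe_mk, AddHom.coe_mk, LinearMap.sum_apply, LinearMap.smul_apply]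
  refine sum_congr rfl fun k _ => ?_
  have hk : 2 ^ (k : ℕ) ≤ 2 ^ m := Nat.pow_le_pow_right (by norm_num) (by omega)
  have hq := HasAntidiagonal.mem_antidiagonal.1 hq
  rw [coord_ampliation (by omega), smul_smul]
  congr 1
  rw [Polynomial.coeff_mul_X_pow', Polynomial.coeff_derivative]
  simp only [lacunarySymbol]
  by_cases h : 2 ^ m - 2 ^ (k : ℕ) ≤ q.1
  · rw [if_pos h, if_pos (by omega),
      show q.1 + 1 + 2 ^ (k : ℕ) - 2 ^ m = q.1 - (2 ^ m - 2 ^ (k : ℕ)) + 1 by omega]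
    push_cast
    ring
  · rw [if_neg h, mul_zero]
    split_ifs with h2
    · rw [show q.1 + 1 + 2 ^ (k : ℕ) - 2 ^ m = 0 by omega]
      simp
    · rfl

theorem norm_aeval_shift_le {N : ℕ} {p : Polynomial ℂ} {M : ℝ}
    (hp : ∀ z : ℂ, ‖z‖ = 1 → ‖p.eval z‖ ≤ M) (x : PiLp 2 (fun _ : Fin N => H)) :
    ‖Polynomial.aeval (shift N) p x‖ ^ 2 ≤ M ^ 2 * ‖x‖ ^ 2 := by
  rw [norm_sq_eq_sum_coord, norm_sq_eq_sum_coord x,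
    sum_congr rfl fun i hi => by rw [coord_aeval_shift p (mem_range.1 hi)]]
  exact sum_norm_sq_coeff_smul_le hp N fun i => coord N i x

theorem norm_aeval_derivative_lacunaryOp_le {m : ℕ} {A : Fin (m + 1) → H →ₗ[ℂ] H}
    (hA : ∀ a v, ‖familyMap A a v‖ ≤ Real.sqrt 2 * ‖a‖ * ‖v‖) {p : Polynomial ℂ} {M : ℝ}
    (hM : 0 ≤ M) (hp : ∀ z : ℂ, ‖z‖ = 1 → ‖p.eval z‖ ≤ M)
    (x : PiLp 2 (fun _ : Fin (2 ^ m) => H)) :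
    ‖Polynomial.aeval (shift (2 ^ m)) (Polynomial.derivative p) (lacunaryOp m A x)‖ ≤
      4 * M * ‖x‖ := by
  refine abs_le_of_sq_le_sq' ?_ (by positivity) |>.2
  rw [norm_sq_eq_sum_coord, mul_pow, norm_sq_eq_sum_coord x,
    sum_congr rfl fun i hi => by rw [coord_aeval_derivative_lacunaryOp m A p (mem_range.1 hi)]]
  refine ((toeplitzBound_lacunarySymbol m hp).sum_norm_sq_le (by positivity) (by positivity)
    (familyMap A) hA fun i => coord (2 ^ m) i x).trans ?_
  refine mul_le_mul_of_nonneg_right ?_ (sum_nonneg fun _ _ => by positivity)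
  rw [mul_pow, Real.sq_sqrt (by norm_num)]
  nlinarith [sq_nonneg M]

/-- The upper triangular operator `(x, y) ↦ (S x + c Y y, S y)`. -/
noncomputable def foguelOp {E : Type*} [NormedAddCommGroup E] [InnerProductSpace ℂ E]
    (S Y : E →ₗ[ℂ] E) (c : ℂ) : WithLp 2 (E × E) →ₗ[ℂ] WithLp 2 (E × E) where
  toFun z := WithLp.toLp 2 (S z.fst + c • Y z.snd, S z.snd)
  map_add' z w := by
    apply (WithLp.ofLp_injective 2)
    ext <;> simp
    abel
  map_smul' t z := by
    apply (WithLp.ofLp_injective 2)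
    ext <;> simp [smul_comm c t]

theorem aeval_foguelOp {E : Type*} [NormedAddCommGroup E] [InnerProductSpace ℂ E]
    {S Y : E →ₗ[ℂ] E} (hSY : Commute S Y) (c : ℂ) (p : Polynomial ℂ) (z : WithLp 2 (E × E)) :
    Polynomial.aeval (foguelOp S Y c) p z =
      WithLp.toLp 2 (Polynomial.aeval S p z.fst +
        c • Polynomial.aeval S (Polynomial.derivative p) (Y z.snd),
        Polynomial.aeval S p z.snd) := by
  have hpow : ∀ n : ℕ, (foguelOp S Y c ^ n) z =
      WithLp.toLp 2 ((S ^ n) z.fst + c • (n : ℂ) • (S ^ (n - 1)) (Y z.snd), (S ^ n) z.snd) := by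
    intro n
    induction n with
    | zero => apply (WithLp.ofLp_injective 2); ext <;> simp
    | succ n ih =>
      rw [pow_succ', Module.End.mul_apply, ih]
      have h1 : Y ((S ^ n) z.snd) = (S ^ n) (Y z.snd) := by
        have := (hSY.pow_left n).eq
        simpa using (LinearMap.congr_fun this z.snd).symm
      apply (WithLp.ofLp_injective 2)
      ext
      · change S ((S ^ n) z.fst + c • (n : ℂ) • (S ^ (n - 1)) (Y z.snd)) +
          c • Y ((S ^ n) z.snd) = (S ^ (n + 1)) z.fst +
            c • ((n + 1 : ℕ) : ℂ) • (S ^ (n + 1 - 1)) (Y z.snd)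
        have h2 : (n : ℂ) • S ((S ^ (n - 1)) (Y z.snd)) = (n : ℂ) • (S ^ n) (Y z.snd) := by
          cases n with
          | zero => simp
          | succ n => rw [← Module.End.mul_apply, ← pow_succ', Nat.add_sub_cancel]
        rw [map_add, map_smul, map_smul, h1, h2, ← Module.End.mul_apply, ← pow_succ',
          Nat.add_sub_cancel]
        push_cast
        module
      · simp [foguelOp, pow_succ']
  induction p using Polynomial.induction_on' with
  | add p q hp hq =>
    simp only [map_add, LinearMap.add_apply, hp, hq]
    apply (WithLp.ofLp_injective 2)
    ext <;> simp
    abel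
  | monomial l a =>
    rw [Polynomial.aeval_monomial, Module.End.mul_apply, hpow, Polynomial.derivative_monomial,
      Polynomial.aeval_monomial, Polynomial.aeval_monomial]
    apply (WithLp.ofLp_injective 2)
    ext
    · simp
      module
    · simp

theorem norm_aeval_foguelOp_le {m : ℕ} {A : Fin (m + 1) → H →ₗ[ℂ] H}
    (hA : ∀ a v, ‖familyMap A a v‖ ≤ Real.sqrt 2 * ‖a‖ * ‖v‖) {c : ℝ} (hc : 0 ≤ c)
    {p : Polynomial ℂ} {M : ℝ} (hM : 0 ≤ M) (hp : ∀ z : ℂ, ‖z‖ = 1 → ‖p.eval z‖ ≤ M)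
    (z : WithLp 2 (PiLp 2 (fun _ : Fin (2 ^ m) => H) × PiLp 2 (fun _ : Fin (2 ^ m) => H))) :
    ‖Polynomial.aeval (foguelOp (shift (2 ^ m)) (lacunaryOp m A) c) p z‖ ≤
      (1 + 4 * c) * M * ‖z‖ := by
  rw [aeval_foguelOp (shift_lacunaryOp_commute m A)]
  set a := Polynomial.aeval (shift (2 ^ m)) p z.fst
  set b := Polynomial.aeval (shift (2 ^ m)) p z.snd
  set e := Polynomial.aeval (shift (2 ^ m)) (Polynomial.derivative p) (lacunaryOp m A z.snd)
  have h1 : WithLp.toLp 2 (a + (c : ℂ) • e, b) =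
      WithLp.toLp 2 (a, b) + WithLp.toLp 2 ((c : ℂ) • e, 0) := by
    exact (WithLp.ofLp_injective 2) (Prod.ext rfl (add_zero b).symm)
  have h2 : ‖WithLp.toLp 2 (a, b)‖ ≤ M * ‖z‖ := by
    refine abs_le_of_sq_le_sq' ?_ (by positivity) |>.2
    rw [mul_pow, WithLp.prod_norm_sq_eq_of_L2, WithLp.prod_norm_sq_eq_of_L2, mul_add]
    exact add_le_add (norm_aeval_shift_le hp _) (norm_aeval_shift_le hp _)
  have hz : ‖z.snd‖ ≤ ‖z‖ := by
    refine abs_le_of_sq_le_sq' ?_ (by positivity) |>.2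
    rw [WithLp.prod_norm_sq_eq_of_L2]
    nlinarith [sq_nonneg ‖z.fst‖]
  have h3 : ‖(WithLp.toLp 2 ((c : ℂ) • e, (0 : PiLp 2 (fun _ : Fin (2 ^ m) => H))))‖ ≤
      c * (4 * M * ‖z‖) := by
    have h4 : ‖(WithLp.toLp 2 ((c : ℂ) • e, (0 : PiLp 2 (fun _ : Fin (2 ^ m) => H))))‖ =
        c * ‖e‖ := by
      rw [WithLp.norm_toLp_fst, norm_smul]
      simp [abs_of_nonneg hc]
    rw [h4]
    gcongr
    exact (norm_aeval_derivative_lacunaryOp_le hA hM hp z.snd).trans (by gcongr)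
  rw [h1]
  refine (norm_add_le _ _).trans ?_
  linarith

theorem lacunarySymbol_X_pow (m : ℕ) (k : Fin (m + 1)) :
    lacunarySymbol m (Polynomial.X ^ 2 ^ (k : ℕ)) (2 ^ m - 1) = EuclideanSpace.single k 1 := by
  have h : 0 < 2 ^ m := by positivity
  ext l
  simp only [lacunarySymbol, PiLp.single_apply]
  have hl : 0 < 2 ^ (l : ℕ) := by positivity
  rw [if_pos (by omega), show 2 ^ m - 1 + 1 + 2 ^ (l : ℕ) - 2 ^ m = 2 ^ (l : ℕ) by omega,
    Polynomial.coeff_X_pow]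
  by_cases hkl : l = k
  · subst hkl; simp
  · have : 2 ^ (l : ℕ) ≠ 2 ^ (k : ℕ) := fun h => hkl (Fin.ext (Nat.pow_right_injective le_rfl h))
    simp [hkl, this]

end Model

theorem exists_defect {V : Type*} [NormedAddCommGroup V] [InnerProductSpace ℂ V]
    [FiniteDimensional ℂ V] (T : V →ₗ[ℂ] V) (hT : ∀ v, ‖T v‖ ≤ ‖v‖) :
    ∃ Δ : V →ₗ[ℂ] V, ∀ v, ‖Δ v‖ ^ 2 = ‖v‖ ^ 2 - ‖T v‖ ^ 2 := by
  have : CompleteSpace V := FiniteDimensional.complete ℂ V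
  let t : V →L[ℂ] V := LinearMap.toContinuousLinearMap T
  have ht : ∀ v, t v = T v := fun v => rfl
  have hin : ∀ v, inner ℂ ((1 - star t * t) v) v = ((‖v‖ ^ 2 - ‖T v‖ ^ 2 : ℝ) : ℂ) := by
    intro v
    rw [_root_.sub_apply, inner_sub_left, one_apply_eq_self, mul_apply_eq_comp,
      ContinuousLinearMap.star_eq_adjoint, ContinuousLinearMap.adjoint_inner_left, ht,
      inner_self_eq_norm_sq_to_K, inner_self_eq_norm_sq_to_K]
    push_cast
    rfl
  have hpos : (0 : V →L[ℂ] V) ≤ 1 - star t * t := by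
    rw [ContinuousLinearMap.nonneg_iff_isPositive, ContinuousLinearMap.isPositive_iff']
    refine ⟨?_, fun v => ?_⟩
    · exact (IsSelfAdjoint.one _).sub (IsSelfAdjoint.star_mul_self t)
    · rw [hin, Complex.zero_le_real]
      have := pow_le_pow_left₀ (norm_nonneg _) (hT v) 2
      linarith
  obtain ⟨b, hb⟩ := CStarAlgebra.nonneg_iff_eq_star_mul_self.1 hpos
  refine ⟨b.toLinearMap, fun v => ?_⟩
  have h1 := hin v
  rw [hb, mul_apply_eq_comp, ContinuousLinearMap.star_eq_adjoint,
    ContinuousLinearMap.adjoint_inner_left, inner_self_eq_norm_sq_to_K] at h1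
  exact Complex.ofReal_injective (by rw [← h1]; push_cast; rfl)

theorem sum_norm_sq_nilpotent_contraction_le {V ι : Type*} [NormedAddCommGroup V]
    [InnerProductSpace ℂ V] [FiniteDimensional ℂ V] [Fintype ι] [DecidableEq ι] {L Q : ℕ} {c : ℝ}
    (D : ℕ → Matrix ι ι ℂ)
    (hD : ∀ z : ℂ, ‖z‖ = 1 → ∀ v : EuclideanSpace ℂ ι,
      ‖∑ l ∈ range L, z ^ l • Matrix.toEuclideanCLM (𝕜 := ℂ) (D l) v‖ ≤ c * ‖v‖)
    (hL : ∀ l, L ≤ l → D l = 0) (T : V →ₗ[ℂ] V) (hT : ∀ v, ‖T v‖ ≤ ‖v‖) (hQ : T ^ Q = 0)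
    (ζ : ι → V) :
    ∑ s, ‖∑ l ∈ range L, ∑ s', D l s s' • (T ^ l) (ζ s')‖ ^ 2 ≤ c ^ 2 * ∑ s, ‖ζ s‖ ^ 2 := by
  obtain ⟨Δ, hΔ⟩ := exists_defect T hT
  have hnorm : ∀ v, ‖v‖ ^ 2 = ∑ i ∈ range Q, ‖Δ ((T ^ (Q - 1 - i)) v)‖ ^ 2 := by
    intro v
    rw [sum_range_reflect (fun j => ‖Δ ((T ^ j) v)‖ ^ 2)]
    have h1 : ∀ j, ‖Δ ((T ^ j) v)‖ ^ 2 = ‖(T ^ j) v‖ ^ 2 - ‖(T ^ (j + 1)) v‖ ^ 2 := by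
      intro j
      rw [hΔ, pow_succ' T, Module.End.mul_apply]
    simp_rw [h1]
    rw [sum_range_sub' (fun j => ‖(T ^ j) v‖ ^ 2), hQ]
    simp
  let e := stdOrthonormalBasis ℂ V
  let x := fun (β : Fin (Module.finrank ℂ V)) (i : ℕ) =>
    (WithLp.toLp 2 fun s => inner ℂ (e β) (Δ ((T ^ (Q - 1 - i)) (ζ s))) : EuclideanSpace ℂ ι)
  have hx : ∀ i, ∑ β, ‖x β i‖ ^ 2 = ∑ s, ‖Δ ((T ^ (Q - 1 - i)) (ζ s))‖ ^ 2 := by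
    intro i
    simp_rw [EuclideanSpace.norm_sq_eq]
    rw [sum_comm]
    exact sum_congr rfl fun s _ => e.sum_sq_norm_inner_right _
  let W := fun s => ∑ l ∈ range L, ∑ s', D l s s' • (T ^ l) (ζ s')
  have hW : ∀ β, ∀ i ∈ range Q, ∀ s, inner ℂ (e β) (Δ ((T ^ (Q - 1 - i)) (W s))) =
      (∑ q ∈ antidiagonal i, Matrix.toEuclideanCLM (𝕜 := ℂ) (D q.1) (x β q.2)) s := by
    intro β i hi s
    have hi := mem_range.1 hi
    have hTz : ∀ l v, i < l → (T ^ (Q - 1 - i)) ((T ^ l) v) = 0 := by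
      intro l v hl
      rw [← Module.End.mul_apply, ← pow_add, show Q - 1 - i + l = Q + (l - i - 1) by omega,
        pow_add, hQ, zero_mul, LinearMap.zero_apply]
    have h1 : inner ℂ (e β) (Δ ((T ^ (Q - 1 - i)) (W s))) = ∑ l ∈ range L, ∑ s',
        D l s s' * inner ℂ (e β) (Δ ((T ^ (Q - 1 - i)) ((T ^ l) (ζ s')))) := by
      simp only [W, map_sum, map_smul, inner_sum, inner_smul_right]
    have h2 : (∑ q ∈ antidiagonal i, Matrix.toEuclideanCLM (𝕜 := ℂ) (D q.1) (x β q.2)) s =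
        ∑ l ∈ range (i + 1), ∑ s',
        D l s s' * inner ℂ (e β) (Δ ((T ^ (Q - 1 - i)) ((T ^ l) (ζ s')))) := by
      rw [Finset.Nat.sum_antidiagonal_eq_sum_range_succ_mk, WithLp.ofLp_sum, Finset.sum_apply]
      refine sum_congr rfl fun l hl => ?_
      have hl := mem_range.1 hl
      rw [Matrix.ofLp_toEuclideanCLM]
      simp only [Matrix.mulVec, dotProduct, x]
      refine sum_congr rfl fun s' _ => ?_
      have h3 : (T ^ (Q - 1 - i)) ((T ^ l) (ζ s')) = (T ^ (Q - 1 - (i - l))) (ζ s') := by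
        rw [← Module.End.mul_apply, ← pow_add, show Q - 1 - i + l = Q - 1 - (i - l) by omega]
      rw [h3]
    rw [h1, h2]
    have hA : ∀ l ∉ range L, ∑ s',
        D l s s' * inner ℂ (e β) (Δ ((T ^ (Q - 1 - i)) ((T ^ l) (ζ s')))) = 0 := by
      intro l hl
      simp [hL l (by simpa using hl)]
    have hB : ∀ l ∉ range (i + 1), ∑ s',
        D l s s' * inner ℂ (e β) (Δ ((T ^ (Q - 1 - i)) ((T ^ l) (ζ s')))) = 0 := by
      intro l hl
      refine sum_eq_zero fun s' _ => ?_
      rw [hTz l _ (by simpa using hl)]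
      simp
    rw [sum_subset (subset_union_left (s₂ := range (i + 1))) fun l _ hl => hA l hl,
      sum_subset (subset_union_right (s₁ := range L)) fun l _ hl => hB l hl]
  have hmul : ∀ β, ∑ i ∈ range Q,
      ‖∑ q ∈ antidiagonal i, Matrix.toEuclideanCLM (𝕜 := ℂ) (D q.1) (x β q.2)‖ ^ 2 ≤
      c ^ 2 * ∑ i ∈ range Q, ‖x β i‖ ^ 2 := fun β =>
    sum_norm_sq_antidiagonal_le (fun l => (Matrix.toEuclideanCLM (𝕜 := ℂ) (D l)).toLinearMap) hD
      (fun l hl => by simp [hL l hl]) Q (x β)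
  calc ∑ s, ‖W s‖ ^ 2
      = ∑ β, ∑ i ∈ range Q,
        ‖∑ q ∈ antidiagonal i, Matrix.toEuclideanCLM (𝕜 := ℂ) (D q.1) (x β q.2)‖ ^ 2 := by
        simp_rw [hnorm (W _), EuclideanSpace.norm_sq_eq, ← e.sum_sq_norm_inner_right (Δ _)]
        rw [sum_comm]
        simp_rw [fun i => sum_comm (s := univ (α := ι)) (t := univ (α := Fin (Module.finrank ℂ V)))
          (f := fun s β => ‖inner ℂ (e β) (Δ ((T ^ (Q - 1 - i)) (W s)))‖ ^ 2)]
        rw [sum_comm]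
        refine sum_congr rfl fun β _ => sum_congr rfl fun i hi => sum_congr rfl fun s _ => ?_
        rw [hW β i hi s]
    _ ≤ ∑ β, c ^ 2 * ∑ i ∈ range Q, ‖x β i‖ ^ 2 := sum_le_sum fun β _ => hmul β
    _ = c ^ 2 * ∑ s, ‖ζ s‖ ^ 2 := by
        rw [← mul_sum, sum_comm]
        simp_rw [hx, hnorm (ζ _)]
        rw [sum_comm]

theorem similarity_lower_bound {V : Type*} [NormedAddCommGroup V] [InnerProductSpace ℂ V]
    [FiniteDimensional ℂ V] {m d Q : ℕ} (hd : 0 < d) {U : Fin (m + 1) → Matrix (Fin d) (Fin d) ℂ}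
    (hU : ∀ k, (U k)ᴴ = U k) (hac : ∀ k l, U k * U l + U l * U k = if k = l then 2 else 0)
    {c : ℝ} (hc : 0 ≤ c) (R : V →ₗ[ℂ] V) (hQ : R ^ Q = 0) (ξ η : Fin d → V)
    (hξ : ∀ s, ‖ξ s‖ = 1) (hη : ∀ s, ‖η s‖ = 1)
    (hR : ∀ (k : Fin (m + 1)) s t, inner ℂ (η s) ((R ^ 2 ^ (k : ℕ)) (ξ t)) = (c : ℂ) * U k s t)
    (a b : V →L[ℂ] V) (hab : a * b = 1) (hba : b * a = 1) (hT : ∀ v, ‖a (R (b v))‖ ≤ ‖v‖) :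
    c ^ 2 * (m + 1) ≤ 2 * (‖a‖ * ‖b‖) ^ 2 := by
  have hab' : ∀ v, a (b v) = v := fun v => by rw [← mul_apply_eq_comp, hab, one_apply_eq_self]
  have hba' : ∀ v, b (a v) = v := fun v => by rw [← mul_apply_eq_comp, hba, one_apply_eq_self]
  let T : V →ₗ[ℂ] V := a.toLinearMap ∘ₗ R ∘ₗ b.toLinearMap
  have hTpow : ∀ j v, (T ^ j) v = a ((R ^ j) (b v)) := by
    intro j
    induction j with
    | zero => intro v; simp [hab']
    | succ j ih =>
      intro v
      rw [pow_succ', Module.End.mul_apply, ih, pow_succ', Module.End.mul_apply]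
      simp [T, hba']
  have hTQ : T ^ Q = 0 := LinearMap.ext fun v => by rw [hTpow, hQ]; simp
  let D : ℕ → Matrix (Fin d) (Fin d) ℂ := fun l =>
    ∑ k : Fin (m + 1), if l = 2 ^ (k : ℕ) then (U k)ᵀ else 0
  have hmem : ∀ k : Fin (m + 1), 2 ^ (k : ℕ) ∈ range (2 ^ m + 1) := fun k =>
    mem_range.2 (Nat.lt_succ_of_le (Nat.pow_le_pow_right (by norm_num) (by omega)))
  have hDL : ∀ l, 2 ^ m + 1 ≤ l → D l = 0 := by
    intro l hl
    refine sum_eq_zero fun k _ => if_neg ?_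
    have := mem_range.1 (hmem k)
    omega
  have hDn : ∀ z : ℂ, ‖z‖ = 1 → ∀ v : EuclideanSpace ℂ (Fin d),
      ‖∑ l ∈ range (2 ^ m + 1), z ^ l • Matrix.toEuclideanCLM (𝕜 := ℂ) (D l) v‖ ≤
        Real.sqrt (2 * (m + 1)) * ‖v‖ := by
    intro z hz v
    have h1 : ∑ l ∈ range (2 ^ m + 1), z ^ l • Matrix.toEuclideanCLM (𝕜 := ℂ) (D l) v =
        ∑ k : Fin (m + 1), z ^ 2 ^ (k : ℕ) • Matrix.toEuclideanCLM (𝕜 := ℂ) (U k)ᵀ v := by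
      simp only [D, map_sum, _root_.sum_apply, smul_sum]
      rw [sum_comm]
      refine sum_congr rfl fun k _ => ?_
      rw [sum_eq_single (2 ^ (k : ℕ))]
      · simp
      · intro l _ hl; simp [hl]
      · intro h; exact absurd (hmem k) h
    have h2 := norm_sq_anticomm_le (fun k => (U k)ᵀ)
      (fun k => by
        conv_rhs => rw [← hU k]
        rfl)
      (fun k l => by
        have := congrArg Matrix.transpose (hac l k)
        rw [Matrix.transpose_add, Matrix.transpose_mul, Matrix.transpose_mul] at this
        rw [this]
        by_cases h : k = l
        · subst h; simp
        · simp [h, Ne.symm h])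
      (WithLp.toLp 2 fun k : Fin (m + 1) => z ^ 2 ^ (k : ℕ)) v
    rw [h1]
    refine abs_le_of_sq_le_sq' ?_ (by positivity) |>.2
    rw [mul_pow, Real.sq_sqrt (by positivity)]
    simpa [hz] using h2
  have hF := sum_norm_sq_nilpotent_contraction_le (L := 2 ^ m + 1) D hDn hDL T hT hTQ
    fun s => a (ξ s)
  let G : Fin d → V := fun s => ∑ l ∈ range (2 ^ m + 1), ∑ s', D l s s' • (R ^ l) (ξ s')
  have hFG : ∀ s, ∑ l ∈ range (2 ^ m + 1), ∑ s', D l s s' • (T ^ l) (a (ξ s')) = a (G s) := by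
    intro s
    simp only [G, map_sum, map_smul, hTpow, hba']
  simp only [hFG] at hF
  have hin : ∑ s, inner ℂ (η s) (G s) = ((c * (m + 1) * d : ℝ) : ℂ) := by
    have h1 : ∀ s, inner ℂ (η s) (G s) = ∑ k, ∑ s', U k s' s * ((c : ℂ) * U k s s') := by
      intro s
      simp only [G, inner_sum, inner_smul_right, D, Matrix.sum_apply, sum_mul]
      rw [sum_congr rfl fun l _ => sum_comm, sum_comm]
      refine sum_congr rfl fun k _ => ?_
      rw [sum_eq_single (2 ^ (k : ℕ))]
      · refine sum_congr rfl fun s' _ => ?_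
        rw [if_pos rfl, hR, Matrix.transpose_apply]
      · intro l _ hl; simp [hl]
      · intro h; exact absurd (hmem k) h
    have h2 : ∀ k, ∑ s, ∑ s', U k s' s * ((c : ℂ) * U k s s') = c * d := by
      intro k
      have h3 := hac k k
      rw [if_pos rfl, ← two_mul] at h3
      have h4 : U k * U k = 1 := by
        have : (2 : ℂ) • (U k * U k) = (2 : ℂ) • (1 : Matrix (Fin d) (Fin d) ℂ) := by
          rw [← Nat.cast_ofNat (n := 2), Nat.cast_smul_eq_nsmul, Nat.cast_smul_eq_nsmul]
          simpa [two_mul, two_smul, ← one_add_one_eq_two, add_mul] using h3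
        exact smul_right_injective _ two_ne_zero this
      calc ∑ s, ∑ s', U k s' s * ((c : ℂ) * U k s s') = c * Matrix.trace (U k * U k) := by
            simp only [Matrix.trace, Matrix.diag, Matrix.mul_apply, mul_sum]
            exact sum_congr rfl fun s _ => sum_congr rfl fun s' _ => by ring
        _ = c * d := by rw [h4]; simp
    simp_rw [h1]
    rw [sum_comm, sum_congr rfl fun k _ => h2 k]
    simp
    ring
  have hlow : c * (m + 1) * d ≤ ‖b‖ * ∑ s, ‖a (G s)‖ := by
    have h1 : ‖∑ s, inner ℂ (η s) (G s)‖ = c * (m + 1) * d := by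
      rw [hin, Complex.norm_real, Real.norm_of_nonneg (by positivity)]
    rw [← h1, mul_sum]
    refine norm_sum_le_of_le _ fun s _ => ?_
    refine (norm_inner_le_norm _ _).trans ?_
    rw [hη, one_mul]
    calc ‖G s‖ = ‖b (a (G s))‖ := by rw [hba']
      _ ≤ _ := b.le_opNorm _
  have hcs : (∑ s, ‖a (G s)‖) ^ 2 ≤ d * ∑ s, ‖a (G s)‖ ^ 2 := by
    simpa using sq_sum_le_card_mul_sum_sq (s := univ (α := Fin d)) (f := fun s => ‖a (G s)‖)
  have hup : ∑ s, ‖a (ξ s)‖ ^ 2 ≤ d * ‖a‖ ^ 2 := by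
    calc ∑ s, ‖a (ξ s)‖ ^ 2 ≤ ∑ _s : Fin d, ‖a‖ ^ 2 := by
          refine sum_le_sum fun s _ => ?_
          gcongr
          simpa [hξ] using a.le_opNorm (ξ s)
      _ = _ := by simp
  rw [Real.sq_sqrt (by positivity)] at hF
  have hd' : (0 : ℝ) < d := by exact_mod_cast hd
  have hfin : (c * (m + 1) * d) ^ 2 ≤ ‖b‖ ^ 2 * (d * (2 * (m + 1) * (d * ‖a‖ ^ 2))) := by
    calc (c * (m + 1) * d) ^ 2 ≤ (‖b‖ * ∑ s, ‖a (G s)‖) ^ 2 :=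
          pow_le_pow_left₀ (by positivity) hlow 2
      _ = ‖b‖ ^ 2 * (∑ s, ‖a (G s)‖) ^ 2 := mul_pow _ _ _
      _ ≤ ‖b‖ ^ 2 * (d * (2 * (m + 1) * (d * ‖a‖ ^ 2))) := by
          gcongr
          refine hcs.trans ?_
          gcongr
          refine hF.trans ?_
          gcongr
  have hpos : (0 : ℝ) < (m + 1) * d ^ 2 := by positivity
  refine le_of_mul_le_mul_right ?_ hpos
  calc c ^ 2 * (m + 1) * ((m + 1) * d ^ 2) = (c * (m + 1) * d) ^ 2 := by ring
    _ ≤ _ := hfin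
    _ = _ := by ring

theorem exists_linearIsometry_of_finrank_le {E W : Type*} [NormedAddCommGroup E]
    [InnerProductSpace ℂ E] [FiniteDimensional ℂ E] [NormedAddCommGroup W] [InnerProductSpace ℂ W]
    [FiniteDimensional ℂ W] (h : Module.finrank ℂ E ≤ Module.finrank ℂ W) :
    Nonempty (E →ₗᵢ[ℂ] W) := by
  let e := stdOrthonormalBasis ℂ E
  let f := stdOrthonormalBasis ℂ W
  refine ⟨(e.toBasis.constr ℂ (fun i => f (Fin.castLE h i))).isometryOfOrthonormal
    (v := e.toBasis) (by simp) ?_⟩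
  have : ⇑(e.toBasis.constr ℂ (fun i => f (Fin.castLE h i))) ∘ ⇑e.toBasis =
      f ∘ Fin.castLE h := by
    ext i
    simp only [Function.comp_apply, Module.Basis.constr_basis]
  rw [this]
  exact f.orthonormal.comp _ (Fin.castLE_injective h)

section Padding

variable {E W : Type*} [NormedAddCommGroup E] [InnerProductSpace ℂ E] [FiniteDimensional ℂ E]
  [NormedAddCommGroup W] [InnerProductSpace ℂ W] [FiniteDimensional ℂ W]

theorem LinearIsometry.adjoint_apply_self (J : E →ₗᵢ[ℂ] W) (u : E) :
    LinearMap.adjoint J.toLinearMap (J u) = u := by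
  refine ext_inner_left ℂ fun v => ?_
  rw [LinearMap.adjoint_inner_right]
  exact J.inner_map_map v u

/-- The operator `J R J*`, extending `R` by zero. -/
noncomputable def padding (J : E →ₗᵢ[ℂ] W) (R : E →ₗ[ℂ] E) : W →ₗ[ℂ] W :=
  J.toLinearMap ∘ₗ R ∘ₗ LinearMap.adjoint J.toLinearMap

theorem padding_pow_succ (J : E →ₗᵢ[ℂ] W) (R : E →ₗ[ℂ] E) (j : ℕ) :
    padding J R ^ (j + 1) = padding J (R ^ (j + 1)) := by
  induction j with
  | zero => simp
  | succ j ih =>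
    rw [pow_succ', ih]
    ext w
    simp [padding, pow_succ' R (j + 1), LinearIsometry.adjoint_apply_self]

theorem aeval_padding (J : E →ₗᵢ[ℂ] W) (R : E →ₗ[ℂ] E) (p : Polynomial ℂ) (w : W) :
    Polynomial.aeval (padding J R) p w =
      J (Polynomial.aeval R p (LinearMap.adjoint J.toLinearMap w)) +
        p.eval 0 • (w - J (LinearMap.adjoint J.toLinearMap w)) := by
  induction p using Polynomial.induction_on' with
  | add p q hp hq =>
    simp only [map_add, LinearMap.add_apply, hp, hq, Polynomial.eval_add]
    module
  | monomial l a =>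
    cases l with
    | zero => simp [Module.algebraMap_end_apply]; module
    | succ l =>
      simp only [Polynomial.aeval_monomial, padding_pow_succ]
      simp [padding, Module.algebraMap_end_apply]

theorem norm_aeval_padding_le (J : E →ₗᵢ[ℂ] W) (R : E →ₗ[ℂ] E) {p : Polynomial ℂ} {C : ℝ}
    (hC : 0 ≤ C) (h0 : ‖p.eval 0‖ ≤ C) (hR : ∀ u, ‖Polynomial.aeval R p u‖ ≤ C * ‖u‖) (w : W) :
    ‖Polynomial.aeval (padding J R) p w‖ ≤ C * ‖w‖ := by
  set P := LinearMap.adjoint J.toLinearMap with hP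
  have horth : ∀ u, inner ℂ (J u) (w - J (P w)) = 0 := by
    intro u
    have h1 : inner ℂ (J u) (w - J (P w)) = inner ℂ u (P (w - J (P w))) :=
      (LinearMap.adjoint_inner_right J.toLinearMap u _).symm
    rw [h1, map_sub, hP, LinearIsometry.adjoint_apply_self, sub_self, inner_zero_right]
  have hw : ‖w‖ ^ 2 = ‖P w‖ ^ 2 + ‖w - J (P w)‖ ^ 2 := by
    have := norm_add_sq_eq_norm_sq_add_norm_sq_of_inner_eq_zero _ _ (horth (P w))
    rw [add_sub_cancel, J.norm_map] at this
    linarith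
  have hv : ‖Polynomial.aeval (padding J R) p w‖ ^ 2 =
      ‖Polynomial.aeval R p (P w)‖ ^ 2 + (‖p.eval 0‖ * ‖w - J (P w)‖) ^ 2 := by
    rw [aeval_padding, ← norm_smul]
    have := norm_add_sq_eq_norm_sq_add_norm_sq_of_inner_eq_zero (𝕜 := ℂ)
      (J (Polynomial.aeval R p (P w))) (p.eval 0 • (w - J (P w)))
      (by rw [inner_smul_right, horth, mul_zero])
    rw [J.norm_map] at this
    linarith
  refine abs_le_of_sq_le_sq' ?_ (by positivity) |>.2
  rw [hv, mul_pow C, hw, mul_add, ← mul_pow, ← mul_pow]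
  gcongr
  exact hR _

end Padding

theorem toEuclideanCLM_aeval {n : ℕ} (M : Matrix (Fin n) (Fin n) ℂ) (p : Polynomial ℂ)
    (w : EuclideanSpace ℂ (Fin n)) :
    Matrix.toEuclideanCLM (𝕜 := ℂ) (Polynomial.aeval M p) w =
      Polynomial.aeval (Matrix.toEuclideanCLM (𝕜 := ℂ) M).toLinearMap p w := by
  induction p using Polynomial.induction_on' with
  | add p q hp hq => simp [hp, hq]
  | monomial l a =>
    rw [Polynomial.aeval_monomial, Polynomial.aeval_monomial, ← Algebra.smul_def, map_smul,
      map_pow, ← Algebra.smul_def, LinearMap.smul_apply, _root_.smul_apply,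
      ← ContinuousLinearMap.toLinearMap_pow]
    rfl

theorem exists_foguel_model (m : ℕ) {c : ℝ} (hc : 0 ≤ c) {n : ℕ} (hn : 2 ^ (2 * m + 1) ≤ n) :
    ∃ R : EuclideanSpace ℂ (Fin n) →ₗ[ℂ] EuclideanSpace ℂ (Fin n),
      (∀ (p : Polynomial ℂ) (M : ℝ), (∀ z : ℂ, ‖z‖ ≤ 1 → ‖p.eval z‖ ≤ M) →
        ∀ v, ‖Polynomial.aeval R p v‖ ≤ (1 + 4 * c) * M * ‖v‖) ∧
      ∀ a b : EuclideanSpace ℂ (Fin n) →L[ℂ] EuclideanSpace ℂ (Fin n), a * b = 1 → b * a = 1 →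
        (∀ v, ‖a (R (b v))‖ ≤ ‖v‖) → c ^ 2 * (m + 1) ≤ 2 * (‖a‖ * ‖b‖) ^ 2 := by
  obtain ⟨U, hU, hac⟩ := exists_anticomm_family m
  let H := EuclideanSpace ℂ (Fin (2 ^ m))
  let E := PiLp 2 (fun _ : Fin (2 ^ m) => H)
  let A : Fin (m + 1) → H →ₗ[ℂ] H := fun k => (Matrix.toEuclideanCLM (𝕜 := ℂ) (U k)).toLinearMap
  have hA : ∀ a v, ‖familyMap A a v‖ ≤ Real.sqrt 2 * ‖a‖ * ‖v‖ := by
    intro a v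
    refine abs_le_of_sq_le_sq' ?_ (by positivity) |>.2
    have h1 := norm_sq_anticomm_le U hU hac a v
    rw [mul_pow, mul_pow, Real.sq_sqrt (by norm_num), EuclideanSpace.norm_sq_eq a]
    simpa [familyMap, A] using h1
  have hS := shift_lacunaryOp_commute m A
  let R₀ := foguelOp (shift (2 ^ m)) (lacunaryOp m A) c
  have hdim : Module.finrank ℂ (WithLp 2 (E × E)) = 2 ^ (2 * m + 1) := by
    rw [(WithLp.linearEquiv 2 ℂ _).finrank_eq, Module.finrank_prod,
      (WithLp.linearEquiv 2 ℂ _).finrank_eq, Module.finrank_pi_fintype]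
    simp [H]
    ring
  obtain ⟨J⟩ := exists_linearIsometry_of_finrank_le (E := WithLp 2 (E × E))
    (W := EuclideanSpace ℂ (Fin n)) (by rw [hdim]; simpa using hn)
  have hshift : shift (H := H) (2 ^ m) ^ 2 ^ m = 0 :=
    LinearMap.ext fun x => ext_coord fun i hi => by
      rw [coord_shift_pow _ hi, if_neg (by omega)]; simp
  have hR₀ : R₀ ^ (2 ^ m + 1) = 0 := by
    refine LinearMap.ext fun z => ?_
    have h1 := aeval_foguelOp hS c (Polynomial.X ^ (2 ^ m + 1)) z
    have h2 : shift (H := H) (2 ^ m) ^ (2 ^ m + 1) = 0 := by rw [pow_succ, hshift, zero_mul]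
    simp only [Polynomial.derivative_X_pow, map_mul, map_pow, Polynomial.aeval_X,
      Nat.add_sub_cancel, hshift, h2, mul_zero] at h1
    rw [h1]
    simp
  have hpos : 0 < 2 ^ m := by positivity
  let i₀ : Fin (2 ^ m) := ⟨0, hpos⟩
  let i₁ : Fin (2 ^ m) := ⟨2 ^ m - 1, by omega⟩
  let f : Fin (2 ^ m) → H := fun s => EuclideanSpace.single s 1
  let x : Fin (2 ^ m) → E := fun s => PiLp.single 2 i₀ (f s)
  let y : Fin (2 ^ m) → E := fun s => PiLp.single 2 i₁ (f s)
  let ξ : Fin (2 ^ m) → WithLp 2 (E × E) := fun s => WithLp.toLp 2 (0, x s)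
  let η : Fin (2 ^ m) → WithLp 2 (E × E) := fun s => WithLp.toLp 2 (y s, 0)
  have hcoord : ∀ t q, coord (2 ^ m) q (x t) = if q = 0 then f t else 0 := by
    intro t q
    by_cases hq : q < 2 ^ m
    · rw [coord_of_lt hq]
      by_cases hq0 : q = 0
      · subst hq0; simp [x, i₀]
      · simp [x, i₀, hq0]
    · simp [coord, hq, show q ≠ 0 by omega]
  have hinner : ∀ (s : Fin (2 ^ m)) (v : E), inner ℂ (y s) v = coord (2 ^ m) (2 ^ m - 1) v s := by
    intro s v
    rw [coord_of_lt (by omega), PiLp.inner_apply, sum_eq_single i₁]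
    · simp only [y, f, i₁, PiLp.single_eq_same]
      exact (EuclideanSpace.inner_single_left _ _ _).trans (by simp)
    · intro j _ hj; simp [y, hj]
    · simp
  have hkey : ∀ (k : Fin (m + 1)) s t,
      inner ℂ (η s) ((R₀ ^ 2 ^ (k : ℕ)) (ξ t)) = (c : ℂ) * U k s t := by
    intro k s t
    have h1 := aeval_foguelOp hS c (Polynomial.X ^ 2 ^ (k : ℕ)) (ξ t)
    rw [map_pow, Polynomial.aeval_X] at h1
    have h2 := coord_aeval_derivative_lacunaryOp m A (Polynomial.X ^ 2 ^ (k : ℕ))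
      (show 2 ^ m - 1 < 2 ^ m by omega) (x t)
    rw [sum_eq_single (2 ^ m - 1, 0)] at h2
    · rw [hcoord, if_pos rfl, lacunarySymbol_X_pow] at h2
      change inner ℂ (η s) ((foguelOp (shift (2 ^ m)) (lacunaryOp m A) c ^ 2 ^ (k : ℕ)) (ξ t)) = _
      rw [h1, WithLp.prod_inner_apply]
      simp only [η, ξ, inner_zero_left, add_zero]
      rw [WithLp.toLp_fst, WithLp.toLp_snd, map_zero, zero_add, inner_smul_right, hinner, h2]
      have h3 : (Matrix.toEuclideanCLM (𝕜 := ℂ) (U k) (f t)) s = U k s t := by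
        rw [Matrix.ofLp_toEuclideanCLM]
        simp [f]
      have h4 : familyMap A (EuclideanSpace.single k 1) (f t) = A k (f t) := by simp [familyMap]
      rw [← h3, h4]
      rfl
    · rintro ⟨i, j⟩ hq hne
      have := HasAntidiagonal.mem_antidiagonal.1 hq
      have hj : j ≠ 0 := by
        rintro rfl
        simp at this
        exact hne (by simp [this])
      simp [hcoord, hj]
    · simp
  have hpow : ∀ k : Fin (m + 1), padding J R₀ ^ 2 ^ (k : ℕ) = padding J (R₀ ^ 2 ^ (k : ℕ)) := by
    intro k
    obtain ⟨j, hj⟩ := Nat.exists_eq_succ_of_ne_zero (pow_ne_zero (k : ℕ) two_ne_zero)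
    rw [hj]
    exact padding_pow_succ J R₀ j
  refine ⟨padding J R₀, fun p M hp => ?_, fun a b hab hba hT => ?_⟩
  · have hM : 0 ≤ M := (norm_nonneg _).trans (hp 0 (by simp))
    refine norm_aeval_padding_le J R₀ (by positivity) ?_ fun u => ?_
    · refine (hp 0 (by simp)).trans ?_
      nlinarith [mul_nonneg hc hM]
    · exact norm_aeval_foguelOp_le hA hc hM (fun z hz => hp z hz.le) u
  · refine similarity_lower_bound hpos hU hac hc (padding J R₀) (Q := 2 ^ m + 1) ?_
      (fun s => J (ξ s)) (fun s => J (η s)) (fun s => ?_) (fun s => ?_) (fun k s t => ?_)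
      a b hab hba hT
    · rw [padding_pow_succ, hR₀]
      ext w
      simp [padding]
    · rw [J.norm_map, WithLp.norm_toLp_snd, PiLp.norm_single, PiLp.norm_single, norm_one]
    · rw [J.norm_map, WithLp.norm_toLp_fst, PiLp.norm_single, PiLp.norm_single, norm_one]
    · rw [hpow, ← hkey]
      simp [padding, LinearIsometry.adjoint_apply_self]

end MatrixPolynomialBounds

/-- Pisier's corollary. There is `δ > 0` such that for all `K > 1` and
`n ≥ 2` there is an `n × n` matrix `R` with polynomial bound `K` whose similarity constant is
at least `δ (K - 1) √(log n)`. -/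
theorem exists_matrix_polyBound_similarity_lower_bound :
    ∃ δ > (0 : ℝ), ∀ K : ℝ, 1 < K → ∀ n : ℕ, 2 ≤ n →
      ∃ R : Matrix (Fin n) (Fin n) ℂ,
        (∀ p : Polynomial ℂ,
          ‖Matrix.toEuclideanCLM (𝕜 := ℂ) (Polynomial.aeval R p)‖ ≤
            K * ⨆ z : Metric.closedBall (0 : ℂ) 1, ‖p.eval (z : ℂ)‖) ∧
        (∀ A : Matrix (Fin n) (Fin n) ℂ, IsUnit A →
          ‖Matrix.toEuclideanCLM (𝕜 := ℂ) (A * R * A⁻¹)‖ ≤ 1 →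
          δ * (K - 1) * Real.sqrt (Real.log n) ≤
            ‖Matrix.toEuclideanCLM (𝕜 := ℂ) A‖ * ‖Matrix.toEuclideanCLM (𝕜 := ℂ) A⁻¹‖) := by
  refine ⟨1 / 10, by norm_num, fun K hK n hn => ?_⟩
  set m := (Nat.log 2 n - 1) / 2 with hm
  have hlog : 1 ≤ Nat.log 2 n := Nat.log_pos (by norm_num) hn
  have h1 : 2 ^ (2 * m + 1) ≤ n :=
    (Nat.pow_le_pow_right (by norm_num) (by omega)).trans (Nat.pow_log_le_self 2 (by omega))
  have h2 : n ≤ 2 ^ (2 * m + 3) :=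
    (Nat.lt_pow_succ_log_self (by norm_num) n).le.trans
      (Nat.pow_le_pow_right (by norm_num) (by omega))
  have hlogn : Real.log n ≤ 3 * (m + 1) := by
    have hn0 : (0 : ℝ) < n := by exact_mod_cast (by omega : 0 < n)
    have h3 : (n : ℝ) ≤ 2 ^ (2 * m + 3) := by exact_mod_cast h2
    have h4 := Real.log_le_log hn0 h3
    rw [Real.log_pow] at h4
    have h5 : Real.log 2 ≤ 1 := by have := Real.log_two_lt_d9; linarith
    have h6 : ((2 * m + 3 : ℕ) : ℝ) * Real.log 2 ≤ ((2 * m + 3 : ℕ) : ℝ) * 1 := by gcongr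
    push_cast at h4 h6
    have h7 : (0 : ℝ) ≤ m := by positivity
    linarith
  have hc : 0 ≤ (K - 1) / 4 := by linarith
  obtain ⟨R, hR, hlow⟩ := exists_foguel_model m hc h1
  set Rm : Matrix (Fin n) (Fin n) ℂ :=
    (Matrix.toEuclideanCLM (𝕜 := ℂ)).symm (LinearMap.toContinuousLinearMap R) with hRm
  have hRm' : Matrix.toEuclideanCLM (𝕜 := ℂ) Rm = LinearMap.toContinuousLinearMap R := by
    rw [hRm, StarAlgEquiv.apply_symm_apply]
  refine ⟨Rm, fun p => ?_, fun A hA hcontr => ?_⟩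
  · set M := ⨆ z : Metric.closedBall (0 : ℂ) 1, ‖p.eval (z : ℂ)‖ with hM
    have hbdd : BddAbove (Set.range fun z : Metric.closedBall (0 : ℂ) 1 => ‖p.eval (z : ℂ)‖) := by
      have : CompactSpace (Metric.closedBall (0 : ℂ) 1) :=
        isCompact_iff_compactSpace.1 (isCompact_closedBall 0 1)
      exact (isCompact_range (by fun_prop)).bddAbove
    have hp : ∀ z : ℂ, ‖z‖ ≤ 1 → ‖p.eval z‖ ≤ M := fun z hz =>
      le_ciSup hbdd ⟨z, by simpa using hz⟩
    have hM0 : 0 ≤ M := (norm_nonneg _).trans (hp 0 (by simp))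
    refine ContinuousLinearMap.opNorm_le_bound _ (by nlinarith) fun v => ?_
    rw [toEuclideanCLM_aeval, hRm']
    refine (hR p M hp v).trans (le_of_eq ?_)
    ring
  · set a := Matrix.toEuclideanCLM (𝕜 := ℂ) A
    set b := Matrix.toEuclideanCLM (𝕜 := ℂ) A⁻¹
    have hdet : IsUnit A.det := (Matrix.isUnit_iff_isUnit_det A).1 hA
    have hab : a * b = 1 := by rw [← map_mul, Matrix.mul_nonsing_inv A hdet, map_one]
    have hba : b * a = 1 := by rw [← map_mul, Matrix.nonsing_inv_mul A hdet, map_one]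
    have hT : ∀ v, ‖a (R (b v))‖ ≤ ‖v‖ := by
      intro v
      have h3 : Matrix.toEuclideanCLM (𝕜 := ℂ) (A * Rm * A⁻¹) v = a (R (b v)) := by
        rw [map_mul, map_mul, hRm']
        rfl
      rw [← h3]
      refine (ContinuousLinearMap.le_opNorm _ v).trans ?_
      nlinarith [norm_nonneg v]
    have h3 := hlow a b hab hba hT
    refine abs_le_of_sq_le_sq' ?_ (by positivity) |>.2
    rw [mul_pow, Real.sq_sqrt (Real.log_natCast_nonneg n)]
    have h4 : (1 / 10 * (K - 1)) ^ 2 * Real.log n ≤ (1 / 10 * (K - 1)) ^ 2 * (3 * (m + 1)) := by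
      gcongr
    have h5 : 0 ≤ (K - 1) ^ 2 * ((m : ℝ) + 1) := by positivity
    nlinarith
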